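/- arXiv:2501.18906 — 6 statements merged into one kernel-verified Lean document; each statement's English description precedes it below -/
import Mathlib

section
/- Let p be an odd prime, let F be a field of characteristic different from p, let k be a field of characteristic p, and let n ≥ 3. Then there exist a field extension K of F and a continuous homomorphism ρ : Γ_K → GL_n(k) that does not lift to W₂(k): no continuous homomorphism ρ̃ : Γ_K → GL_n(W₂(k)) satisfies π ∘ ρ̃ = ρ. -/
open Matrix Topology

/-- The reduction ring homomorphism `π : W₂(k) → k` from the ring of `p`-typical length-`2`
Witt vectors of `k` to `k`, given by the zeroth Witt coefficient. -/
noncomputable def wittReduce (p : ℕ) [hp : Fact p.Prime] (k : Type*) [CommRing k] :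
    TruncatedWittVector p 2 k →+* k where
  toFun x := x.coeff 0
  map_one' := by
    show TruncatedWittVector.coeff 0 (1 : TruncatedWittVector p 2 k) = 1
    rw [show (1 : TruncatedWittVector p 2 k) = WittVector.truncate 2 (1 : WittVector p k) from
        (_root_.map_one _).symm, WittVector.coeff_truncate]
    simpa using WittVector.one_coeff_zero p k
  map_mul' x y := by
    show TruncatedWittVector.coeff 0 (x * y)
        = TruncatedWittVector.coeff 0 x * TruncatedWittVector.coeff 0 y
    obtain ⟨a, ha⟩ := WittVector.truncate_surjective (p := p) 2 k x
    obtain ⟨b, hb⟩ := WittVector.truncate_surjective (p := p) 2 k y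
    rw [← ha, ← hb, ← _root_.map_mul, WittVector.coeff_truncate, WittVector.coeff_truncate,
      WittVector.coeff_truncate]
    simpa using WittVector.mul_coeff_zero a b
  map_zero' := by
    show TruncatedWittVector.coeff 0 (0 : TruncatedWittVector p 2 k) = 0
    rw [show (0 : TruncatedWittVector p 2 k) = WittVector.truncate 2 (0 : WittVector p k) from
        (_root_.map_zero _).symm, WittVector.coeff_truncate]
    simpa using WittVector.zero_coeff p k 0
  map_add' x y := by
    show TruncatedWittVector.coeff 0 (x + y)
        = TruncatedWittVector.coeff 0 x + TruncatedWittVector.coeff 0 y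
    obtain ⟨a, ha⟩ := WittVector.truncate_surjective (p := p) 2 k x
    obtain ⟨b, hb⟩ := WittVector.truncate_surjective (p := p) 2 k y
    rw [← ha, ← hb, ← _root_.map_add, WittVector.coeff_truncate, WittVector.coeff_truncate,
      WittVector.coeff_truncate]
    simpa using WittVector.add_coeff_zero a b


section
variable {A k : Type*} [CommRing A] [CommRing k] {π : A →+* k} {ι : Type*} [Fintype ι]
  [DecidableEq ι]

omit [DecidableEq ι] in
theorem mul_eq_of_map_eq (hI : ∀ x y, π x = 0 → π y = 0 → x * y = 0) {B B' Y : Matrix ι ι A}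
    (hB : B.map π = B'.map π) (hY : Y.map π = 0) : B * Y = B' * Y := by
  rw [← sub_eq_zero, ← Matrix.sub_mul]
  ext i j
  rw [Matrix.mul_apply]
  refine Finset.sum_eq_zero fun l _ => hI _ _ ?_ (by simpa using congrFun₂ hY l j)
  simpa [sub_eq_zero] using congrFun₂ hB i l

omit [DecidableEq ι] in
theorem mul_eq_of_map_eq' (hI : ∀ x y, π x = 0 → π y = 0 → x * y = 0) {B B' Y : Matrix ι ι A}
    (hB : B.map π = B'.map π) (hY : Y.map π = 0) : Y * B = Y * B' := by
  rw [← sub_eq_zero, ← Matrix.mul_sub]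
  ext i j
  rw [Matrix.mul_apply]
  refine Finset.sum_eq_zero fun l _ => hI _ _ (by simpa using congrFun₂ hY i l) ?_
  simpa [sub_eq_zero] using congrFun₂ hB l j

omit [Fintype ι] in
theorem map_transvection (f : A →+* k) (i j : ι) (c : A) :
    (transvection i j c).map f = transvection i j (f c) := by
  simp only [transvection, Matrix.map_add _ (map_add f), Matrix.map_one _ (map_zero f) (map_one f)]
  congr 1
  ext a b
  simp [Matrix.single_apply, apply_ite f]

theorem mul_sub_one_entry (hI : ∀ x y, π x = 0 → π y = 0 → x * y = 0) {M M' : Matrix ι ι A}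
    (hM : M.map π = 1) (hM' : M'.map π = 1) : M * M' - 1 = (M - 1) + (M' - 1) := by
  have h : M * (M' - 1) = 1 * (M' - 1) := mul_eq_of_map_eq hI
    (by rw [hM, Matrix.map_one _ (map_zero π) (map_one π)])
    (by rw [Matrix.map_sub _ (map_sub π), hM', Matrix.map_one _ (map_zero π) (map_one π), sub_self])
  rw [one_mul, mul_sub, mul_one, sub_eq_iff_eq_add] at h
  rw [h]; abel

theorem conj_transvection_entry (hI : ∀ x y, π x = 0 → π y = 0 → x * y = 0) {a b : ι} (hab : a ≠ b)
    {B M M' : Matrix ι ι A} (hB : B.map π = transvection a b 1) (hM : M.map π = 1)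
    (hM' : M'.map π = 1) (h : B * M = M' * B) (i j : ι) :
    (M' - 1) i j = (M - 1) i j + (if i = a then (M - 1) b j else 0)
      - (if j = b then (M - 1) i a else 0)
      - (if i = a then if j = b then (M - 1) b a else 0 else 0) := by
  have h1 : (1 : Matrix ι ι A).map π = 1 := Matrix.map_one _ (map_zero π) (map_one π)
  have hB' : B.map π = (transvection a b (1 : A)).map π := by rw [hB, map_transvection, map_one]
  have h2 : B * (M - 1) = (M' - 1) * B := by rw [mul_sub, sub_mul, h, mul_one, one_mul]
  rw [mul_eq_of_map_eq hI hB' (by rw [Matrix.map_sub _ (map_sub π), hM, h1, sub_self]),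
    mul_eq_of_map_eq' hI hB' (by rw [Matrix.map_sub _ (map_sub π), hM', h1, sub_self])] at h2
  have h3 : M' - 1 = transvection a b 1 * (M - 1) * transvection a b (-1) := by
    rw [h2, mul_assoc, transvection_mul_transvection_same _ _ hab]
    simp
  rw [h3]
  by_cases hj : j = b
  · subst hj
    rw [mul_transvection_apply_same]
    by_cases hi : i = a
    · subst hi
      simp only [transvection_mul_apply_same, if_true]
      ring
    · simp only [transvection_mul_apply_of_ne _ _ _ _ hi, hi, if_false, if_true]
      ring
  · rw [mul_transvection_apply_of_ne _ _ _ _ hj]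
    by_cases hi : i = a
    · subst hi
      simp [transvection_mul_apply_same, hj]
    · simp [transvection_mul_apply_of_ne _ _ _ _ hi, hi, hj]

theorem one_add_pow_of_cube_eq_zero {R : Type*} [Ring R] {U : R} (hU : U * U * U = 0) (m : ℕ) :
    (1 + U) ^ m = 1 + m • U + m.choose 2 • (U * U) := by
  induction m with
  | zero => simp
  | succ m ih =>
    rw [pow_succ, ih, Nat.choose_succ_succ' m 1, Nat.choose_one_right, mul_add, mul_one, add_mul,
      add_mul, smul_mul_assoc, smul_mul_assoc, hU, smul_zero, one_mul, add_smul, add_smul, one_smul]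
    abel

theorem corner_mul (hI : ∀ x y, π x = 0 → π y = 0 → x * y = 0) {a c : ι} (hac : a ≠ c)
    {M M' : Matrix ι ι A} (hM : ∀ j, π (M c j) = if j = c then 1 else 0)
    (hM' : ∀ i, π (M' i a) = if i = a then 1 else 0) :
    (M * M') c a = M c a + M' c a := by
  rw [Matrix.mul_apply, ← Finset.sum_subset (Finset.subset_univ {a, c}),
    Finset.sum_pair hac]
  · have h1 := hI (M c a) (M' a a - 1) (by simp [hM, hac]) (by simp [hM'])
    have h2 := hI (M c c - 1) (M' c a) (by simp [hM]) (by simp [hM', hac.symm])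
    linear_combination h1 + h2
  · intro x _ hx
    simp only [Finset.mem_insert, Finset.mem_singleton, not_or] at hx
    exact hI _ _ (by simp [hM, hx.2]) (by simp [hM', hx.1])

/-- If `s`, `t`, `z` lift the elementary matrices `E₁₂`, `E₂₃`, `E₁₃` modulo a square-zero ideal and
`s t = z t s`, then the corner entry of `z ^ p` is `p`. -/
theorem pow_prime_sub_one_entry {p : ℕ} [Fact p.Prime] (hodd : Odd p) (hp : π p = 0)
    (hI : ∀ x y, π x = 0 → π y = 0 → x * y = 0) {a b c : ι} (hab : a ≠ b) (hbc : b ≠ c)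
    (hac : a ≠ c) {S T Z : Matrix ι ι A} (hS : S.map π = transvection a b 1)
    (hT : T.map π = transvection b c 1) (hZ : Z.map π = transvection a c 1)
    (h : S * T = Z * (T * S)) : (Z ^ p - 1) a c = p := by
  have hS' : ∀ i j, π (S i j) = transvection a b (1 : k) i j := fun i j => congrFun₂ hS i j
  have hT' : ∀ i j, π (T i j) = transvection b c (1 : k) i j := fun i j => congrFun₂ hT i j
  have hZ' : ∀ i j, π (Z i j) = transvection a c (1 : k) i j := fun i j => congrFun₂ hZ i j
  have hTS : ∀ i, π ((T * S) i a) = if i = a then 1 else 0 := by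
    intro i
    have : π ((T * S) i a) =
        (transvection b c (1 : k) * transvection a b 1 : Matrix ι ι k) i a := by
      rw [← hT, ← hS, ← Matrix.map_mul]; rfl
    rw [this, mul_transvection_apply_of_ne _ _ _ _ hab]
    simp [transvection, Matrix.one_apply, hac.symm]
  have hcorner : Z c a = 0 := by
    have h1 := congrFun₂ h c a
    rw [corner_mul hI hac, corner_mul hI hac, corner_mul hI hac] at h1
    · linear_combination -h1
    all_goals intro i
    all_goals first | exact hTS i | rw [hS'] | rw [hT'] | rw [hZ']
    all_goals simp [transvection, Matrix.one_apply, hac, hbc, hac.symm, hab.symm, eq_comm]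
  set E : Matrix ι ι A := Matrix.single a c 1 with hE
  obtain ⟨Y, hY⟩ : ∃ Y, Z = 1 + (E + Y) := ⟨Z - transvection a c 1, by
    rw [transvection, ← hE]; abel⟩
  have hYπ : Y.map π = 0 := by
    have : Y = Z - transvection a c 1 := by rw [hY, transvection, ← hE]; abel
    rw [this, Matrix.map_sub _ (map_sub π), hZ, map_transvection, map_one, sub_self]
  have hYca : Y c a = 0 := by
    rw [hY] at hcorner
    simpa [hE, Matrix.one_apply, Matrix.single_apply, hac, hac.symm] using hcorner
  have hEE : E * E = 0 := Matrix.single_mul_single_of_ne _ _ _ _ hac.symm _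
  have hYY : ∀ B, Y * B * Y = 0 := by
    intro B
    have h0 : (Y * B).map π = (0 : Matrix ι ι A).map π := by
      rw [Matrix.map_mul, hYπ, Matrix.zero_mul, Matrix.map_zero _ (map_zero π)]
    rw [mul_eq_of_map_eq hI h0 hYπ, Matrix.zero_mul]
  have hYY1 : Y * Y = 0 := by simpa using hYY 1
  have hEYE : E * Y * E = 0 := by
    rw [hE, Matrix.single_mul_mul_single, hYca]; simp
  have hU : (E + Y) * (E + Y) = E * Y + Y * E := by
    rw [add_mul, mul_add, mul_add, hEE, hYY1]; abel
  have hU3 : (E + Y) * (E + Y) * (E + Y) = 0 := by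
    rw [hU, add_mul, mul_add, mul_add, hEYE, hYY, mul_assoc, mul_assoc, hEE, hYY1]
    simp
  have hpI : ∀ x, π x = 0 → (p : A) * x = 0 := fun x hx => hI _ _ hp hx
  have hpM : ∀ B : Matrix ι ι A, B.map π = 0 → p • B = 0 := by
    intro B hB
    ext i j
    simpa using hpI _ (congrFun₂ hB i j)
  obtain ⟨d, hd⟩ : p ∣ p.choose 2 := (Fact.out : p.Prime).dvd_choose_self two_ne_zero
    (lt_of_le_of_ne (Fact.out : p.Prime).two_le fun h => by
      rw [← h] at hodd
      exact absurd hodd (by decide))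
  rw [hY, one_add_pow_of_cube_eq_zero hU3, hd, hU, mul_comm p d, mul_smul, hpM (E * Y + Y * E),
    smul_zero d, add_zero, add_sub_cancel_left, smul_add, hpM Y hYπ, add_zero]
  · simp [hE]
  · rw [Matrix.map_add _ (map_add π), Matrix.map_mul, Matrix.map_mul, hYπ]
    simp
end

theorem transvection_commutator {R ι : Type*} [CommRing R] [Fintype ι] [DecidableEq ι] {a b c : ι}
    (hbc : b ≠ c) (hac : a ≠ c) :
    transvection a b (1 : R) * transvection b c 1 =
      transvection a c 1 * (transvection b c 1 * transvection a b 1) := by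
  simp only [transvection, mul_add, add_mul, mul_one, one_mul, Matrix.single_mul_single_same,
    Matrix.single_mul_single_of_ne _ _ _ _ hac.symm,
    Matrix.single_mul_single_of_ne _ _ _ _ hbc.symm, add_zero]
  abel

theorem transvection_mul_comm {R ι : Type*} [CommRing R] [Fintype ι] [DecidableEq ι] {a b c d : ι}
    (hbc : b ≠ c) (hda : d ≠ a) : transvection a b (1 : R) * transvection c d 1 =
      transvection c d 1 * transvection a b 1 := by
  simp only [transvection, mul_add, add_mul, mul_one, one_mul,
    Matrix.single_mul_single_of_ne _ _ _ _ hbc, Matrix.single_mul_single_of_ne _ _ _ _ hda,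
    add_zero]
  abel

/-- The elementary matrix `1 + E_ij` as an element of the general linear group. -/
def transvectionGL {R ι : Type*} [CommRing R] [Fintype ι] [DecidableEq ι] {i j : ι} (h : i ≠ j) :
    GL ι R where
  val := transvection i j 1
  inv := transvection i j (-1)
  val_inv := by rw [transvection_mul_transvection_same _ _ h]; simp
  inv_val := by rw [transvection_mul_transvection_same _ _ h]; simp

theorem transvectionGL_pow_prime {p : ℕ} {ι : Type*} [Fintype ι] [DecidableEq ι]
    {i j : ι} (h : i ≠ j) : transvectionGL (R := ZMod p) h ^ p = 1 := by
  have key : ∀ m : ℕ, ((transvectionGL (R := ZMod p) h ^ m : GL ι (ZMod p)) : Matrix ι ι (ZMod p)) =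
      transvection i j (m : ZMod p) := by
    intro m
    induction m with
    | zero => simp
    | succ m ih =>
      rw [pow_succ, Units.val_mul, ih, transvectionGL, transvection_mul_transvection_same _ _ h]
      push_cast; rfl
  apply Units.ext
  rw [key]; simp

theorem TruncatedWittVector.mul_eq_zero_of_coeff_zero (p : ℕ) [Fact p.Prime] (k : Type*)
    [CommRing k] [CharP k p] (x y : TruncatedWittVector p 2 k) (hx : x.coeff 0 = 0)
    (hy : y.coeff 0 = 0) : x * y = 0 := by
  obtain ⟨a, rfl⟩ := WittVector.truncate_surjective (p := p) 2 k x
  obtain ⟨b, rfl⟩ := WittVector.truncate_surjective (p := p) 2 k y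
  rw [WittVector.coeff_truncate] at hx hy
  have key : ∀ c : WittVector p k, c.coeff 0 = 0 → ∃ c', c = WittVector.verschiebung c' := by
    intro c hc
    refine ⟨c.shift 1, ?_⟩
    have := WittVector.verschiebung_shift c 0 (by simpa using hc)
    simpa [WittVector.shift] using this.symm
  obtain ⟨a, rfl⟩ := key a hx
  obtain ⟨b, rfl⟩ := key b hy
  rw [← map_mul, ← WittVector.verschiebung_mul_frobenius, WittVector.frobenius_verschiebung,
    ← mul_assoc]
  ext i
  rw [WittVector.coeff_truncate]
  fin_cases i
  · simp
  · simp [WittVector.verschiebung_coeff_succ, WittVector.mul_coeff_zero, WittVector.coeff_p_zero]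

theorem TruncatedWittVector.natCast_prime_ne_zero (p : ℕ) [Fact p.Prime] (k : Type*) [CommRing k]
    [Nontrivial k] [CharP k p] : (p : TruncatedWittVector p 2 k) ≠ 0 := by
  rw [← map_natCast (WittVector.truncate (p := p) 2 (R := k))]
  intro h
  have := congrArg (TruncatedWittVector.coeff 1) h
  rw [WittVector.coeff_truncate] at this
  simp [WittVector.coeff_p_one] at this

theorem exists_addMonoidHom_zmod_eq_one {p : ℕ} [Fact p.Prime] {V : Type*} [AddCommGroup V]
    (hV : ∀ v : V, p • v = 0) {v : V} (hv : v ≠ 0) : ∃ f : V →+ ZMod p, f v = 1 := by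
  have : Module (ZMod p) V := AddCommGroup.zmodModule hV
  obtain ⟨f, hf⟩ : ∃ f : Module.Dual (ZMod p) V, f v ≠ 0 := by
    by_contra! h
    exact hv ((Module.forall_dual_apply_eq_zero_iff (ZMod p) v).1 h)
  exact ⟨((f v)⁻¹ • f).toAddMonoidHom, inv_mul_cancel₀ hf⟩

theorem exists_functional_natCast_eq_one {p : ℕ} [Fact p.Prime] {A k : Type*} [CommRing A]
    [CommRing k] {π : A →+* k} (hI : ∀ x y, π x = 0 → π y = 0 → x * y = 0) (hp : π p = 0)
    (hp0 : (p : A) ≠ 0) :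
    ∃ l : A → ZMod p, (∀ x y, π x = 0 → π y = 0 → l (x + y) = l x + l y) ∧ l p = 1 := by
  classical
  have mem {x : A} (hx : π x = 0) : x ∈ π.toAddMonoidHom.ker := hx
  obtain ⟨f, hf⟩ := exists_addMonoidHom_zmod_eq_one (p := p) (V := π.toAddMonoidHom.ker)
    (fun x => Subtype.ext ((nsmul_eq_mul p (x : A)).trans (hI _ _ hp x.2))) (v := ⟨p, mem hp⟩)
    fun h => hp0 (congrArg Subtype.val h)
  refine ⟨fun x => if hx : x ∈ π.toAddMonoidHom.ker then f ⟨x, hx⟩ else 0,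
    fun x y hx hy => ?_, ?_⟩
  · simp only [dif_pos (mem hx), dif_pos (mem hy), dif_pos (add_mem (mem hx) (mem hy)), ← map_add]
    rfl
  · simp only [dif_pos (mem hp), hf]


theorem exists_orbit_transversal {p : ℕ} [Fact p.Prime] {G X : Type*} [Group G] [MulAction G X]
    (g : G) (D : Finset X) (hD : ∀ x ∈ D, g • x ∈ D) (hfree : ∀ x ∈ D, g • x ≠ x)
    (hg : ∀ x ∈ D, g ^ p • x = x) :
    ∃ Q ⊆ D, Set.InjOn (fun q : X × ℕ => g ^ q.2 • q.1) ↑(Q ×ˢ Finset.range p) ∧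
      ∀ x, x ∈ D ↔ ∃ q ∈ Q ×ˢ Finset.range p, g ^ q.2 • q.1 = x := by
  classical
  induction D using Finset.strongInduction with
  | H D ih =>
  rcases D.eq_empty_or_nonempty with rfl | ⟨x, hx⟩
  · exact ⟨∅, by simp⟩
  have hpow : ∀ i : ℕ, ∀ y ∈ D, g ^ i • y ∈ D := by
    intro i y hy
    induction i with
    | zero => simpa
    | succ i ih => rw [pow_succ', mul_smul]; exact hD _ ih
  have hp := (Fact.out : p.Prime)
  have hper : MulAction.period g x = p :=
    (Nat.dvd_prime hp).1 (MulAction.pow_smul_eq_iff_period_dvd.mp (hg x hx)) |>.resolve_left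
      fun h => hfree x hx (by simpa [h] using MulAction.pow_period_smul g x)
  have hinj : ∀ i < p, ∀ j < p, g ^ i • x = g ^ j • x → i = j := by
    intro i hi j hj h
    have h1 : (i : ℕ) ≡ j [MOD p] := by
      wlog hij : i ≤ j generalizing i j
      · exact (this j hj i hi h.symm (by omega)).symm
      obtain ⟨d, rfl⟩ := Nat.exists_eq_add_of_le hij
      rw [pow_add, mul_smul] at h
      have := MulAction.pow_smul_eq_iff_period_dvd.mp (MulAction.injective _ h).symm
      rw [hper] at this
      exact (Nat.modEq_iff_dvd' (by omega)).2 (by simpa using this)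
    exact Nat.ModEq.eq_of_lt_of_lt h1 hi hj
  set O := (Finset.range p).image fun i => g ^ i • x with hO
  have hOg : ∀ y ∈ D, g • y ∈ O → y ∈ O := by
    intro y hy h
    obtain ⟨i, hi, h⟩ := Finset.mem_image.1 h
    have hi' := Finset.mem_range.1 hi
    rcases Nat.eq_zero_or_pos i with rfl | hpos
    · refine Finset.mem_image.2 ⟨p - 1, Finset.mem_range.2 (Nat.sub_lt hp.pos one_pos), ?_⟩
      apply MulAction.injective g
      change g • _ = g • _
      rw [smul_smul, ← pow_succ', Nat.sub_add_cancel hp.one_le, hg x hx]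
      simpa using h
    · refine Finset.mem_image.2 ⟨i - 1, Finset.mem_range.2 (by omega), ?_⟩
      apply MulAction.injective g
      change g • _ = g • _
      rw [smul_smul, ← pow_succ', Nat.sub_add_cancel hpos, h]
  have hxO : x ∈ O := Finset.mem_image.2 ⟨0, Finset.mem_range.2 hp.pos, by simp⟩
  obtain ⟨Q, hQ, hQinj, hQmem⟩ := ih (D \ O)
    (Finset.sdiff_ssubset (by
      intro y hy
      obtain ⟨i, -, rfl⟩ := Finset.mem_image.1 hy
      exact hpow i x hx) ⟨x, hxO⟩)
    (fun y hy => by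
      rw [Finset.mem_sdiff] at hy ⊢
      exact ⟨hD _ hy.1, fun h => hy.2 (hOg _ hy.1 h)⟩)
    (fun y hy => hfree y (Finset.mem_sdiff.1 hy).1)
    (fun y hy => hg y (Finset.mem_sdiff.1 hy).1)
  refine ⟨insert x Q, Finset.insert_subset hx (hQ.trans Finset.sdiff_subset), ?_, ?_⟩
  · have key : ∀ q ∈ Q, ∀ i < p, ∀ j < p, g ^ i • x ≠ g ^ j • q := by
      intro q hq i hi j hj h
      have h1 := (hQmem (g ^ j • q)).2 ⟨(q, j), by simp [hq, hj], rfl⟩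
      exact (Finset.mem_sdiff.1 h1).2 (h ▸ Finset.mem_image.2 ⟨i, Finset.mem_range.2 hi, rfl⟩)
    rintro ⟨q, i⟩ hq ⟨r, j⟩ hr h
    simp only [Finset.coe_product, Set.mem_prod, Finset.mem_coe, Finset.mem_insert,
      Finset.mem_range] at hq hr h
    obtain ⟨rfl | hq, hi⟩ := hq <;> obtain ⟨rfl | hr, hj⟩ := hr
    · rw [hinj i hi j hj h]
    · exact (key r hr i hi j hj h).elim
    · exact (key q hq j hj i hi h.symm).elim
    · exact hQinj (by simp [hq, hi]) (by simp [hr, hj]) h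
  · intro y
    constructor
    · intro hy
      by_cases hyO : y ∈ O
      · obtain ⟨i, hi, rfl⟩ := Finset.mem_image.1 hyO
        exact ⟨(x, i), by simpa using hi, rfl⟩
      · obtain ⟨⟨q, i⟩, hq, rfl⟩ := (hQmem y).1 (Finset.mem_sdiff.2 ⟨hy, hyO⟩)
        exact ⟨(q, i), by simp at hq ⊢; tauto, rfl⟩
    · rintro ⟨⟨q, i⟩, hq, rfl⟩
      apply hpow
      simp only [Finset.mem_product, Finset.mem_insert] at hq
      rcases hq.1 with rfl | h
      · exact hx
      · exact (Finset.mem_sdiff.1 (hQ h)).1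

theorem exists_prod_eq_prod_orbits {p : ℕ} [Fact p.Prime] {G X : Type*} [Group G] [MulAction G X]
    (g : G) (D : Finset X) (hD : ∀ x ∈ D, g • x ∈ D) (hfree : ∀ x ∈ D, g • x ≠ x)
    (hg : ∀ x ∈ D, g ^ p • x = x) (M N : Type*) [AddCommMonoid M] [CommMonoid N] :
    ∃ Q ⊆ D,
      (∀ f : X → M, ∑ x ∈ D, f x = ∑ q ∈ Q, ∑ i ∈ Finset.range p, f (g ^ i • q)) ∧
      (∀ f : X → N, ∏ x ∈ D, f x = ∏ q ∈ Q, ∏ i ∈ Finset.range p, f (g ^ i • q)) := by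
  classical
  obtain ⟨Q, hQ, hinj, hmem⟩ := exists_orbit_transversal g D hD hfree hg
  have hDQ : D = (Q ×ˢ Finset.range p).image fun q => g ^ q.2 • q.1 := by
    ext x; rw [hmem, Finset.mem_image]
  refine ⟨Q, hQ, fun f => ?_, fun f => ?_⟩
  · rw [hDQ, Finset.sum_image hinj, Finset.sum_product]
  · rw [hDQ, Finset.prod_image hinj, Finset.prod_product]

theorem sum_range_cast_eq_zero {p : ℕ} (hodd : Odd p) (a b : ZMod p) :
    ∑ i ∈ Finset.range p, (a + i * b) = 0 := by
  have h : (2 : ZMod p) * ∑ i ∈ Finset.range p, (i : ZMod p) = 0 := by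
    have := congrArg (Nat.cast : ℕ → ZMod p) (Finset.sum_range_id_mul_two p)
    push_cast at this
    simpa [mul_comm] using this
  have h2 : IsUnit (2 : ZMod p) := by
    have := (ZMod.isUnit_iff_coprime 2 p).2 (Nat.coprime_two_left.2 hodd)
    simpa using this
  rw [h2.mul_right_eq_zero] at h
  rw [Finset.sum_add_distrib, ← Finset.sum_mul, h]
  simp

theorem cocycle_pow {G X A : Type*} [Group G] [MulAction G X] [CommGroup A] {c : G → X → A}
    (hc : ∀ g h x, c (g * h) x = c g (h • x) * c h x) (g : G) (x : X) (m : ℕ) :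
    c (g ^ m) x = ∏ i ∈ Finset.range m, c g (g ^ i • x) := by
  induction m with
  | zero => simpa using hc 1 1 x
  | succ m ih => rw [pow_succ', hc, ih, Finset.prod_range_succ, mul_comm]

theorem AddChar.map_mul_eq_pow_val {p : ℕ} [NeZero p] {A : Type*} [CommMonoid A]
    (e : AddChar (ZMod p) A) (a b : ZMod p) : e (a * b) = e a ^ b.val := by
  rw [← AddChar.map_nsmul_eq_pow, nsmul_eq_mul, ZMod.natCast_zmod_val, mul_comm]

theorem AddChar.map_finsetSum_eq_prod {A M ι : Type*} [AddCommMonoid A] [CommMonoid M]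
    (e : AddChar A M) (s : Finset ι) (f : ι → A) : e (∑ i ∈ s, f i) = ∏ i ∈ s, e (f i) := by
  classical
  induction s using Finset.induction_on with
  | empty => simp
  | insert i s hi ih => rw [Finset.sum_insert hi, Finset.prod_insert hi, e.map_add_eq_mul, ih]

/-- The combinatorial obstruction: the corner coefficients of a lift of the relations of the
Heisenberg group, evaluated on `z ^ p`, sum to zero. -/
theorem sum_mul_eq_zero_of_cocycle {p : ℕ} [Fact p.Prime] (hodd : Odd p) {G X A : Type*} [Group G]
    [MulAction G X] [CommGroup A] {c : G → X → A}
    (hc : ∀ g h x, c (g * h) x = c g (h • x) * c h x)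
    {H : Subgroup G} (hHX : ∀ h ∈ H, ∀ x : X, h • x = x) (hHc : ∀ h ∈ H, ∀ x, c h x ^ p = 1)
    {s t z : G} (hst : s * t = z * (t * s)) (hsH : s ^ p ∈ H) (htH : t ^ p ∈ H) (hzH : z ^ p ∈ H)
    (hzs : ∃ h ∈ H, z * s = s * z * h) (hzt : ∃ h ∈ H, z * t = t * z * h)
    (e : AddChar (ZMod p) A) (he : Function.Injective e)
    {μ φ α β η ψ : X → ZMod p} (hμ : ∀ x, c (z ^ p) x = e (μ x))
    (hφs : ∀ x, φ (s • x) = φ x + β x) (hβs : ∀ x, β (s • x) = β x)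
    (hφt : ∀ x, φ (t • x) = φ x - α x) (hαt : ∀ x, α (t • x) = α x)
    (hφz : ∀ x, φ (z • x) = φ x + η x - ψ x) (hηz : ∀ x, η (z • x) = η x - 2 * ψ x)
    (hψs : ∀ x, ψ (s • x) = ψ x) (hψt : ∀ x, ψ (t • x) = ψ x) (hψz : ∀ x, ψ (z • x) = ψ x)
    (S : Finset X) (hS : ∀ g : G, ∀ x ∈ S, g • x ∈ S) :
    ∑ x ∈ S, μ x * φ x = 0 := by
  classical
  have hzs' : ∀ x : X, z • s • x = s • z • x := by
    intro x
    obtain ⟨h, hh, e⟩ := hzs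
    rw [smul_smul, e, mul_smul, hHX h hh, mul_smul]
  have hzt' : ∀ x : X, z • t • x = t • z • x := by
    intro x
    obtain ⟨h, hh, e⟩ := hzt
    rw [smul_smul, e, mul_smul, hHX h hh, mul_smul]
  have hfix : ∀ x : X, z • x = x → c (z ^ p) x = c z x ^ p := by
    intro x hx
    have h1 : ∀ i : ℕ, z ^ i • x = x := by
      intro i
      induction i with
      | zero => simp
      | succ i ih => rw [pow_succ', mul_smul, ih, hx]
    rw [cocycle_pow hc]
    simp [h1]
  have hμu : ∀ u : G, (∃ h ∈ H, z * u = u * z * h) → ∀ x : X, z • x = x → μ (u • x) = μ x := by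
    rintro u ⟨h, hh, hu⟩ x hx
    apply he
    have h3 : z • u • x = u • x := by
      rw [smul_smul, hu, mul_smul, hHX h hh, mul_smul, hx]
    rw [← hμ, ← hμ, hfix x hx, hfix _ h3]
    have h2 := hc z u x
    rw [hu, hc, hc, hHX h hh, hx, mul_assoc, mul_comm, mul_left_inj] at h2
    rw [← h2, mul_pow, hHc h hh, mul_one]
  have hlin : ∀ u : G, (∃ h ∈ H, z * u = u * z * h) → u ^ p ∈ H → ∀ δ : X → ZMod p,
      (∀ x, φ (u • x) = φ x + δ x) → (∀ x, δ (u • x) = δ x) → ∀ D : Finset X,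
      (∀ x ∈ D, u • x ∈ D) → (∀ x ∈ D, z • x = x) → (∀ x ∈ D, u • x ≠ x) →
      ∑ x ∈ D, μ x * φ x = 0 := by
    intro u hu hup δ hφ hδ D hD hDz hDu
    obtain ⟨Q, hQ, hsum, -⟩ := exists_prod_eq_prod_orbits u D hD hDu
      (fun x _ => hHX _ hup x) (ZMod p) (ZMod p)
    rw [hsum]
    refine Finset.sum_eq_zero fun q hq => ?_
    have h1 : ∀ i : ℕ, u ^ i • q ∈ D ∧ μ (u ^ i • q) = μ q ∧ δ (u ^ i • q) = δ q ∧
        φ (u ^ i • q) = φ q + i * δ q := by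
      intro i
      induction i with
      | zero => simp [hQ hq]
      | succ i ih =>
        obtain ⟨h1, h2, h3, h4⟩ := ih
        rw [pow_succ', mul_smul]
        refine ⟨hD _ h1, by rw [hμu u hu _ (hDz _ h1), h2], by rw [hδ, h3], ?_⟩
        rw [hφ, h3, h4]; push_cast; ring
    calc _ = ∑ i ∈ Finset.range p, μ q * (φ q + i * δ q) :=
          Finset.sum_congr rfl fun i _ => by rw [(h1 i).2.1, (h1 i).2.2.2]
      _ = 0 := by rw [← Finset.mul_sum, sum_range_cast_eq_zero hodd, mul_zero]
  rw [← Finset.sum_filter_add_sum_filter_not S (fun x => z • x = x)]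
  have hfixed : ∑ x ∈ S with z • x = x, μ x * φ x = 0 := by
    rw [← Finset.sum_filter_add_sum_filter_not _ (fun x => s • x = x)]
    rw [hlin s hzs hsH β hφs hβs (Finset.filter (fun x => ¬ s • x = x) _), add_zero,
      ← Finset.sum_filter_add_sum_filter_not _ (fun x => t • x = x),
      hlin t hzt htH (fun x => - α x) (fun x => by rw [hφt, sub_eq_add_neg])
        (fun x => by rw [hαt]) (Finset.filter (fun x => ¬ t • x = x) _), add_zero]
    · refine Finset.sum_eq_zero fun x hx => ?_
      simp only [Finset.mem_filter] at hx
      obtain ⟨⟨⟨-, hz⟩, hs⟩, ht⟩ := hx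
      have h1 : c z x = 1 := by
        have := congrArg (fun g => c g x) hst
        simp only [hc, hs, ht, mul_smul] at this
        rw [mul_comm (c t x) (c s x)] at this
        exact (mul_eq_right.1 this.symm)
      have : μ x = 0 := he (by rw [← hμ, hfix x hz, h1, one_pow, AddChar.map_zero_eq_one])
      rw [this, zero_mul]
    · intro x hx
      simp only [Finset.mem_filter] at hx ⊢
      obtain ⟨⟨⟨hxS, hz⟩, hs⟩, ht⟩ := hx
      refine ⟨⟨⟨hS _ _ hxS, by rw [hzt', hz]⟩, ?_⟩, fun h => ht (MulAction.injective t h)⟩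
      rw [smul_smul, hst, mul_smul, mul_smul, hs, hzt', hz]
    · intro x hx
      simp only [Finset.mem_filter] at hx
      exact hx.1.1.2
    · intro x hx
      simp only [Finset.mem_filter] at hx
      exact hx.2
    · intro x hx
      simp only [Finset.mem_filter] at hx ⊢
      obtain ⟨⟨hxS, hz⟩, hs⟩ := hx
      exact ⟨⟨hS _ _ hxS, by rw [hzs', hz]⟩, fun h => hs (MulAction.injective s h)⟩
    · intro x hx
      simp only [Finset.mem_filter] at hx
      exact hx.1.2
    · intro x hx
      simp only [Finset.mem_filter] at hx
      exact hx.2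
  rw [hfixed, zero_add]
  set D := S.filter fun x => ¬ z • x = x with hDdef
  have hDs : ∀ x, x ∈ D → s • x ∈ D := fun x hx => by
    simp only [hDdef, Finset.mem_filter] at hx ⊢
    exact ⟨hS _ _ hx.1, fun h => hx.2 (MulAction.injective s (by simpa only [hzs'] using h))⟩
  have hDt : ∀ x, x ∈ D → t • x ∈ D := fun x hx => by
    simp only [hDdef, Finset.mem_filter] at hx ⊢
    exact ⟨hS _ _ hx.1, fun h => hx.2 (MulAction.injective t (by simpa only [hzt'] using h))⟩
  have hDz : ∀ x, x ∈ D → z • x ∈ D := fun x hx => by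
    simp only [hDdef, Finset.mem_filter] at hx ⊢
    exact ⟨hS _ _ hx.1, fun h => hx.2 (MulAction.injective z h)⟩
  obtain ⟨Q, hQ, hsum, hprod⟩ := exists_prod_eq_prod_orbits z D hDz
    (fun x hx => (Finset.mem_filter.1 hx).2) (fun x _ => hHX _ hzH x) (ZMod p) A
  have hμz : ∀ x, μ (z • x) = μ x := by
    intro x
    apply he
    rw [← hμ, ← hμ]
    have h1 := hc (z ^ p) z x
    rw [← pow_succ, pow_succ', hc, hHX _ hzH, mul_comm, mul_left_inj] at h1
    exact h1.symm
  have hz : ∀ (x : X) (i : ℕ), μ (z ^ i • x) = μ x ∧ ψ (z ^ i • x) = ψ x ∧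
      η (z ^ i • x) = η x - 2 * i * ψ x ∧ φ (z ^ i • x) = φ x + i * η x - i ^ 2 * ψ x := by
    intro x i
    induction i with
    | zero => simp
    | succ i ih =>
      obtain ⟨h1, h2, h3, h4⟩ := ih
      rw [pow_succ', mul_smul]
      refine ⟨by rw [hμz, h1], by rw [hψz, h2], ?_, ?_⟩
      · rw [hηz, h2, h3]; push_cast; ring
      · rw [hφz, h4, h3, h2]; push_cast; ring
  have hC : ∏ x ∈ D, c z x ^ (ψ x).val = 1 := by
    have hmul : ∀ g u : G, (∀ x ∈ D, u • x ∈ D) → (∀ x, ψ (u • x) = ψ x) →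
        ∏ x ∈ D, c (g * u) x ^ (ψ x).val =
          (∏ x ∈ D, c g x ^ (ψ x).val) * ∏ x ∈ D, c u x ^ (ψ x).val := by
      intro g u hu hψ
      simp only [hc, mul_pow, Finset.prod_mul_distrib]
      congr 1
      refine Finset.prod_bij (fun x _ => u • x) hu (fun _ _ _ _ h => MulAction.injective u h)
        ?_ (fun x _ => by rw [hψ])
      intro y hy
      obtain ⟨x, hx, h⟩ := Finset.surj_on_of_inj_on_of_card_le (s := D) (t := D)
        (fun x _ => u • x) hu (fun _ _ _ _ h => MulAction.injective u h) le_rfl y hy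
      exact ⟨x, hx, h.symm⟩
    have h := hmul s t hDt hψt
    rw [hst, hmul z (t * s) (fun x hx => by rw [mul_smul]; exact hDt _ (hDs _ hx))
      (fun x => by rw [mul_smul, hψt, hψs]), hmul t s hDs hψs, mul_comm (∏ x ∈ D, c t x ^ _)] at h
    exact mul_eq_right.1 h
  have hψ0 : ∑ q ∈ Q, μ q * ψ q = 0 := by
    apply he
    rw [AddChar.map_zero_eq_one, AddChar.map_finsetSum_eq_prod, ← hC, hprod]
    refine Finset.prod_congr rfl fun q _ => ?_
    rw [AddChar.map_mul_eq_pow_val, ← hμ, cocycle_pow hc, ← Finset.prod_pow]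
    exact Finset.prod_congr rfl fun i _ => by rw [(hz q i).2.1]
  calc ∑ x ∈ D, μ x * φ x
      = ∑ q ∈ Q, (μ q * ∑ i ∈ Finset.range p, (φ q + i * η q) -
          μ q * ψ q * ∑ i ∈ Finset.range p, (i : ZMod p) ^ 2) := by
        rw [hsum]
        refine Finset.sum_congr rfl fun q _ => ?_
        rw [Finset.mul_sum, Finset.mul_sum, ← Finset.sum_sub_distrib]
        refine Finset.sum_congr rfl fun i _ => ?_
        rw [(hz q i).1, (hz q i).2.2.2]
        ring
    _ = 0 := by
        simp only [sum_range_cast_eq_zero hodd, mul_zero, zero_sub]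
        rw [Finset.sum_neg_distrib, ← Finset.sum_mul, hψ0, zero_mul, neg_zero]


section Kummer

variable {p : ℕ} [Fact p.Prime] {C R Ω Γ X : Type*} [Field C] [CommRing R] [IsDomain R]
  [Algebra C R]
  [Field Ω] [Algebra C Ω] [Algebra R Ω] [IsScalarTower C R Ω] [FaithfulSMul R Ω]
  [Group Γ] [MulSemiringAction Γ R] [MulSemiringAction Γ Ω] [SMulCommClass Γ C Ω] [MulAction Γ X]

theorem exists_algebraMap_mul_of_pow_eq {ζ : C} (hζ : IsPrimitiveRoot ζ p) {S T : Ω} (hS : S ≠ 0)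
    (hST : T ^ p = S ^ p) : ∃ c : C, T = algebraMap C Ω c * S := by
  have hζ' := hζ.map_of_injective (algebraMap C Ω).injective
  have : NeZero p := ⟨(Fact.out : p.Prime).ne_zero⟩
  obtain ⟨i, -, hi⟩ := hζ'.eq_pow_of_pow_eq_one (ξ := T / S)
    (by rw [div_pow, hST, div_self (pow_ne_zero _ hS)])
  exact ⟨ζ ^ i, by rw [map_pow, hi, div_mul_cancel₀ _ hS]⟩

omit [FaithfulSMul R Ω] in
theorem exists_algebraMap_mul_of_associated {ζ : C} (hζ : IsPrimitiveRoot ζ p)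
    (hroot : ∀ c : C, ∃ d, d ^ p = c) (hunit : ∀ u : Rˣ, ∃ c : C, (u : R) = algebraMap C R c)
    {a b : R} (hab : Associated a b) {S T : Ω} (hS : S ≠ 0)
    (hSb : S ^ p = algebraMap R Ω a) (hTa : T ^ p = algebraMap R Ω b) :
    ∃ c : C, T = algebraMap C Ω c * S := by
  obtain ⟨u, rfl⟩ := hab
  obtain ⟨c, hc⟩ := hunit u
  obtain ⟨d, rfl⟩ := hroot c
  have hd : d ≠ 0 := by
    rintro rfl
    rw [zero_pow (Fact.out : p.Prime).ne_zero, map_zero] at hc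
    exact u.ne_zero hc
  obtain ⟨c, h⟩ := exists_algebraMap_mul_of_pow_eq hζ (S := algebraMap C Ω d * S) (T := T)
    (mul_ne_zero (by simpa using hd) hS)
    (by rw [mul_pow, hTa, hSb, map_mul, hc, ← IsScalarTower.algebraMap_apply, map_pow, mul_comm])
  exact ⟨c * d, by rw [h, map_mul, mul_assoc]⟩

/-- The action of `Γ` on chosen `p`-th roots `θ x` of representatives of the irreducibles of `R`
is described by a cocycle with values in the constants. -/
theorem exists_cocycle {ζ : C} (hζ : IsPrimitiveRoot ζ p)
    (hroot : ∀ c : C, ∃ d, d ^ p = c) (hunit : ∀ u : Rˣ, ∃ c : C, (u : R) = algebraMap C R c)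
    (hequiv : ∀ (g : Γ) (r : R), g • algebraMap R Ω r = algebraMap R Ω (g • r))
    {rep : X → R} (hrep : ∀ x, Irreducible (rep x))
    (hsmul : ∀ (g : Γ) x, Associated (rep (g • x)) (g • rep x))
    {θ : X → Ω} (hθ : ∀ x, θ x ^ p = algebraMap R Ω (rep x)) :
    ∃ c : Γ → X → Cˣ, (∀ g x, g • θ x = algebraMap C Ω (c g x) * θ (g • x)) ∧
      ∀ g h x, c (g * h) x = c g (h • x) * c h x := by
  have hθ0 : ∀ x, θ x ≠ 0 := by
    intro x h
    have := hθ x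
    rw [h, zero_pow (Fact.out : p.Prime).ne_zero] at this
    exact (hrep x).ne_zero (by simpa using this.symm)
  have h1 : ∀ (g : Γ) x, ∃ c : C, g • θ x = algebraMap C Ω c * θ (g • x) := fun g x =>
    exists_algebraMap_mul_of_associated hζ hroot hunit (hsmul g x) (hθ0 _) (hθ _)
      (by rw [← smul_pow', hθ, hequiv])
  choose c hc using h1
  have hc0 : ∀ g x, c g x ≠ 0 := by
    intro g x h
    have := hc g x
    rw [h, map_zero, zero_mul, smul_eq_zero_iff_eq] at this
    exact hθ0 x this
  refine ⟨fun g x => Units.mk0 (c g x) (hc0 g x), hc, fun g h x => ?_⟩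
  ext
  apply (algebraMap C Ω).injective
  apply mul_right_cancel₀ (hθ0 ((g * h) • x))
  have h2 := hc (g * h) x
  rw [mul_smul, hc h, Algebra.algebraMap_eq_smul_one, smul_mul_assoc, one_mul, smul_comm g,
    hc g] at h2
  simp only [Units.val_mul, Units.val_mk0, map_mul]
  rw [← h2, Algebra.smul_def, mul_smul]
  ring

variable {ζ : C} {rep : X → R} {θ : X → Ω} {c : Γ → X → Cˣ} {H : Subgroup Γ}

omit [IsDomain R] in
theorem smul_eq_of_acts_trivially
    (hH : ∀ h ∈ H, ∀ r : R, h • r = r) (hinj : ∀ x y, Associated (rep x) (rep y) → x = y)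
    (hsmul : ∀ (g : Γ) x, Associated (rep (g • x)) (g • rep x)) {h : Γ} (hh : h ∈ H) (x : X) :
    h • x = x :=
  hinj _ _ (by simpa [hH h hh] using hsmul h x)

omit [Fact p.Prime] [IsDomain R] [Algebra C R] [IsScalarTower C R Ω] [SMulCommClass Γ C Ω] in
theorem cocycle_pow_eq_one
    (hequiv : ∀ (g : Γ) (r : R), g • algebraMap R Ω r = algebraMap R Ω (g • r))
    (hH : ∀ h ∈ H, ∀ r : R, h • r = r) (hHX : ∀ h ∈ H, ∀ x : X, h • x = x)
    (hθ : ∀ x, θ x ^ p = algebraMap R Ω (rep x)) (hrep : ∀ x, Irreducible (rep x))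
    (hc : ∀ g x, g • θ x = algebraMap C Ω (c g x) * θ (g • x)) {h : Γ} (hh : h ∈ H) (x : X) :
    c h x ^ p = 1 := by
  ext
  apply (algebraMap C Ω).injective
  have h1 : h • θ x ^ p = θ x ^ p := by rw [hθ, hequiv, hH h hh]
  rw [smul_pow', hc, hHX h hh, mul_pow] at h1
  have h2 : θ x ^ p ≠ 0 := by rw [hθ]; simpa using (hrep x).ne_zero
  simpa using (mul_eq_right₀ h2).1 h1

omit [SMulCommClass Γ C Ω] in
theorem smul_prod_eq (hHX : ∀ h ∈ H, ∀ x : X, h • x = x)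
    (hc : ∀ g x, g • θ x = algebraMap C Ω (c g x) * θ (g • x)) {e : AddChar (ZMod p) Cˣ}
    {m : Γ → X → ZMod p} (hm : ∀ h ∈ H, ∀ x, c h x = e (m h x)) {h : Γ} (hh : h ∈ H) (n : X →₀ ℕ) :
    h • n.prod (fun x i => θ x ^ i) =
      algebraMap C Ω (e (n.sum fun x i => i * m h x)) * n.prod (fun x i => θ x ^ i) := by
  induction n using Finsupp.induction_linear with
  | zero => simp
  | add f g hf hg =>
    rw [Finsupp.prod_add_index' (by simp) (by simp [pow_add]), smul_mul', hf, hg,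
      Finsupp.sum_add_index' (by simp) (by simp [add_mul]), AddChar.map_add_eq_mul, Units.val_mul,
      map_mul]
    ring
  | single x i =>
    rw [Finsupp.prod_single_index (h := fun x i => θ x ^ i) (pow_zero _),
      Finsupp.sum_single_index (by simp), smul_pow', hc, hHX h hh, hm h hh, ← nsmul_eq_mul,
      AddChar.map_nsmul_eq_pow, Units.val_pow_eq_pow_val, map_pow, mul_pow]

theorem exists_associated_prod [UniqueFactorizationMonoid R]
    (hsurj : ∀ a : R, Irreducible a → ∃ x, Associated (rep x) a) {a : R} (ha : a ≠ 0) :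
    ∃ n : X →₀ ℕ, Associated (n.prod fun x i => rep x ^ i) a := by
  classical
  induction a using UniqueFactorizationMonoid.induction_on_prime with
  | h₁ => exact (ha rfl).elim
  | h₂ a hu => exact ⟨0, by simpa using (associated_one_iff_isUnit.2 hu).symm⟩
  | h₃ a q ha' hq ih =>
    obtain ⟨n, hn⟩ := ih ha'
    obtain ⟨x, hx⟩ := hsurj q hq.irreducible
    refine ⟨Finsupp.single x 1 + n, ?_⟩
    rw [Finsupp.prod_add_index' (by simp) (by simp [pow_add]),
      Finsupp.prod_single_index (by simp), pow_one]
    exact hx.mul_mul hn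

/-- Kummer theory for a factorial ring: a character of `H` of exponent `p` is a combination of the
characters attached to the `p`-th roots of irreducibles. -/
theorem exists_coefficients [UniqueFactorizationMonoid R] (hζ : IsPrimitiveRoot ζ p)
    (hroot : ∀ c : C, ∃ d, d ^ p = c) (hunit : ∀ u : Rˣ, ∃ c : C, (u : R) = algebraMap C R c)
    (hHX : ∀ h ∈ H, ∀ x : X, h • x = x)
    (hequiv : ∀ (g : Γ) (r : R), g • algebraMap R Ω r = algebraMap R Ω (g • r))
    (hH : ∀ h ∈ H, ∀ r : R, h • r = r)
    (hfix : ∀ x : Ω, (∀ h ∈ H, h • x = x) → ∃ e : ℕ, p.Coprime e ∧ ∃ a b : R, b ≠ 0 ∧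
      x ^ e * algebraMap R Ω b = algebraMap R Ω a)
    (hrep : ∀ x, Irreducible (rep x))
    (hsurj : ∀ a : R, Irreducible a → ∃ x, Associated (rep x) a)
    (hθ : ∀ x, θ x ^ p = algebraMap R Ω (rep x))
    (hc : ∀ g x, g • θ x = algebraMap C Ω (c g x) * θ (g • x)) {e : AddChar (ZMod p) Cˣ}
    (he : Function.Injective e)
    {m : Γ → X → ZMod p} (hm : ∀ h ∈ H, ∀ x, c h x = e (m h x)) {χ : Γ → ZMod p}
    {β : Ω} (hβ : β ≠ 0) (hχ : ∀ h ∈ H, h • β = algebraMap C Ω (e (χ h)) * β) :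
    ∃ a : X →₀ ZMod p, ∀ h ∈ H, χ h = Finsupp.linearCombination (ZMod p) (m h) a := by
  have hp0 : p ≠ 0 := (Fact.out : p.Prime).ne_zero
  have he1 : ∀ y, (algebraMap C Ω (e y)) ^ p = 1 := by
    intro y
    rw [← map_pow, ← Units.val_pow_eq_pow_val, ← AddChar.map_nsmul_eq_pow]
    simp
  obtain ⟨d, hd, a, b, hb, hab⟩ := hfix (β ^ p) fun h hh => by
    rw [smul_pow', hχ h hh, mul_pow, he1, one_mul]
  have hjb : algebraMap R Ω b ≠ 0 := by simpa using hb
  set T := β ^ d * algebraMap R Ω b with hT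
  have hT0 : T ≠ 0 := mul_ne_zero (pow_ne_zero _ hβ) hjb
  have hTp : T ^ p = algebraMap R Ω (a * b ^ (p - 1)) := by
    rw [map_mul, ← hab, map_pow, hT, mul_pow, mul_assoc, ← pow_succ', Nat.sub_add_cancel
      (Nat.one_le_iff_ne_zero.2 hp0), ← pow_mul, ← pow_mul, mul_comm d]
  obtain ⟨n, hn⟩ := exists_associated_prod hsurj (a := a * b ^ (p - 1)) (by
    intro h
    rw [h, map_zero] at hTp
    exact pow_ne_zero _ hT0 hTp)
  have hθ0 : ∀ x, θ x ≠ 0 := by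
    intro x h
    have := hθ x
    rw [h, zero_pow hp0] at this
    exact (hrep x).ne_zero (by simpa using this.symm)
  obtain ⟨k, hk⟩ := exists_algebraMap_mul_of_associated hζ hroot hunit hn
    (S := n.prod fun x i => θ x ^ i) (Finset.prod_ne_zero_iff.2 fun x _ => pow_ne_zero _ (hθ0 x))
    (by simp only [Finsupp.prod, ← Finset.prod_pow, map_prod, map_pow, ← hθ, ← pow_mul, mul_comm])
    hTp
  refine ⟨n.mapRange (fun i : ℕ => (d : ZMod p)⁻¹ * (i : ZMod p)) (by simp), fun h hh => ?_⟩
  have h1 : h • T = algebraMap C Ω (e (d * χ h)) * T := by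
    rw [hT, smul_mul', smul_pow', hχ h hh, hequiv, hH h hh, ← nsmul_eq_mul,
      AddChar.map_nsmul_eq_pow, mul_pow, Units.val_pow_eq_pow_val, map_pow, mul_assoc]
  have h2 : h • T = algebraMap C Ω (e (n.sum fun x i => i * m h x)) * T := by
    rw [hk, smul_mul', smul_prod_eq hHX hc hm hh, Algebra.algebraMap_eq_smul_one k, smul_comm h,
      smul_one]
    ring
  rw [h1] at h2
  have h3 := he (Units.ext ((algebraMap C Ω).injective (mul_right_cancel₀ hT0 h2)))
  have hd0 : (d : ZMod p) ≠ 0 := by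
    rw [Ne, ZMod.natCast_eq_zero_iff]
    exact (Nat.Prime.coprime_iff_not_dvd Fact.out).1 hd
  rw [Finsupp.linearCombination_apply, Finsupp.sum_mapRange_index (by simp)]
  simp only [smul_eq_mul, mul_assoc]
  rw [← Finsupp.mul_sum, ← h3, inv_mul_cancel_left₀ hd0]

omit [Algebra C R] [IsScalarTower C R Ω] [MulSemiringAction Γ R] [SMulCommClass Γ C Ω] in
theorem coefficients_unique [UniqueFactorizationMonoid R]
    (hHX : ∀ h ∈ H, ∀ x : X, h • x = x)
    (hfix : ∀ x : Ω, (∀ h ∈ H, h • x = x) → ∃ e : ℕ, p.Coprime e ∧ ∃ a b : R, b ≠ 0 ∧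
      x ^ e * algebraMap R Ω b = algebraMap R Ω a)
    (hrep : ∀ x, Irreducible (rep x)) (hinj : ∀ x y, Associated (rep x) (rep y) → x = y)
    (hθ : ∀ x, θ x ^ p = algebraMap R Ω (rep x))
    (hc : ∀ g x, g • θ x = algebraMap C Ω (c g x) * θ (g • x)) {e : AddChar (ZMod p) Cˣ}
    {m : Γ → X → ZMod p} (hm : ∀ h ∈ H, ∀ x, c h x = e (m h x)) {a : X →₀ ZMod p}
    (ha : ∀ h ∈ H, Finsupp.linearCombination (ZMod p) (m h) a = 0) : a = 0 := by
  classical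
  set n : X →₀ ℕ := a.mapRange ZMod.val (by simp) with hn
  obtain ⟨d, hd, A, B, hB, hAB⟩ := hfix (n.prod fun x i => θ x ^ i) fun h hh => by
    rw [smul_prod_eq hHX hc hm hh, hn, Finsupp.sum_mapRange_index (by simp)]
    have : (a.sum fun x i => (i.val : ZMod p) * m h x) = 0 := by
      rw [← ha h hh, Finsupp.linearCombination_apply]
      simp
    rw [this]
    simp
  have hR : (n.prod fun x i => rep x ^ i) ^ d * B ^ p = A ^ p := by
    apply FaithfulSMul.algebraMap_injective R Ω
    rw [map_pow _ A, ← hAB, mul_pow, map_mul, map_pow, map_pow]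
    congr 1
    simp only [Finsupp.prod, ← Finset.prod_pow, map_prod, map_pow, ← hθ]
    refine Finset.prod_congr rfl fun x _ => ?_
    ring
  have hA : A ≠ 0 := by
    rintro rfl
    rw [zero_pow (Fact.out : p.Prime).ne_zero, mul_eq_zero] at hR
    refine hR.elim (fun h => ?_) (pow_ne_zero _ hB)
    exact pow_ne_zero _ (Finset.prod_ne_zero_iff.2 fun x _ => pow_ne_zero _ (hrep x).ne_zero) h
  ext x
  by_contra hx
  have hP : Prime (rep x) := (hrep x).prime
  have hxn : x ∈ n.support := by
    rw [Finsupp.mem_support_iff, hn, Finsupp.mapRange_apply]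
    simpa using hx
  have hfin : ∀ {y : R}, y ≠ 0 → FiniteMultiplicity (rep x) y := fun hy =>
    FiniteMultiplicity.of_not_isUnit (hrep x).not_isUnit hy
  have hrest : ¬ rep x ∣ ∏ y ∈ n.support.erase x, rep y ^ n y := by
    rw [Prime.dvd_finsetProd_iff hP]
    rintro ⟨y, hy, h⟩
    exact (Finset.mem_erase.1 hy).1
      (hinj _ _ ((hrep x).associated_of_dvd (hrep y) (hP.dvd_of_dvd_pow h))).symm
  have hrest0 : ∏ y ∈ n.support.erase x, rep y ^ n y ≠ 0 := fun h => hrest (h ▸ dvd_zero _)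
  have hmul : multiplicity (rep x) (n.prod fun x i => rep x ^ i) = n x := by
    rw [Finsupp.prod, ← Finset.mul_prod_erase _ _ hxn, multiplicity_mul hP (hfin
      (mul_ne_zero (pow_ne_zero _ hP.ne_zero) hrest0)), multiplicity_pow_self_of_prime hP,
      multiplicity_eq_zero.2 hrest, add_zero]
  have hprod0 : (n.prod fun x i => rep x ^ i) ≠ 0 :=
    Finset.prod_ne_zero_iff.2 fun x _ => pow_ne_zero _ (hrep x).ne_zero
  have h1 := congrArg (multiplicity (rep x)) hR
  rw [multiplicity_mul hP (hfin (mul_ne_zero (pow_ne_zero _ hprod0) (pow_ne_zero _ hB))),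
    (hfin hprod0).multiplicity_pow hP, (hfin hB).multiplicity_pow hP,
    (hfin hA).multiplicity_pow hP, hmul] at h1
  have h2 : p ∣ d * n x := (Nat.dvd_add_left (dvd_mul_right p _)).1 (h1 ▸ dvd_mul_right p _)
  have h3 := hd.dvd_of_dvd_mul_left h2
  rw [hn, Finsupp.mapRange_apply] at h3
  exact hx (by simpa using Nat.eq_zero_of_dvd_of_lt h3 (ZMod.val_lt _))

end Kummer


theorem apply_smul_of_conj {p : ℕ} {Γ X A : Type*} [Group Γ] [MulAction Γ X] [CommGroup A]
    {c : Γ → X → A} (hcoc : ∀ g h x, c (g * h) x = c g (h • x) * c h x) {H : Subgroup Γ}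
    [H.Normal] (hHX : ∀ h ∈ H, ∀ x : X, h • x = x) {e : AddChar (ZMod p) A}
    (he : Function.Injective e) {m : Γ → X → ZMod p} (hm : ∀ h ∈ H, ∀ x, c h x = e (m h x))
    (huniq : ∀ a : X →₀ ZMod p,
      (∀ h ∈ H, Finsupp.linearCombination (ZMod p) (m h) a = 0) → a = 0)
    {χ : Γ → ZMod p} {a a' : X →₀ ZMod p}
    (ha : ∀ h ∈ H, χ h = Finsupp.linearCombination (ZMod p) (m h) a) (g : Γ)
    (ha' : ∀ h ∈ H, χ (g * h * g⁻¹) = Finsupp.linearCombination (ZMod p) (m h) a') (x : X) :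
    a (g • x) = a' x := by
  have hconj : ∀ h ∈ H, ∀ x, m (g * h * g⁻¹) x = m h (g⁻¹ • x) := by
    intro h hh x
    apply he
    rw [← hm h hh, ← hm _ (Subgroup.Normal.conj_mem ‹_› h hh g), hcoc, hcoc, hHX h hh]
    have h1 := hcoc g g⁻¹ x
    have h2 : c 1 x = 1 := by simpa using hcoc 1 1 x
    rw [mul_inv_cancel, h2] at h1
    rw [mul_right_comm, ← h1, one_mul]
  have h1 : a.mapDomain (fun x => g⁻¹ • x) - a' = 0 := huniq _ fun h hh => by
    rw [map_sub, ← ha' h hh, Finsupp.linearCombination_mapDomain,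
      ha _ (Subgroup.Normal.conj_mem ‹_› h hh g), sub_eq_zero]
    congr 2
    funext x
    exact (hconj h hh x).symm
  rw [← sub_eq_zero.1 h1]
  have := Finsupp.mapDomain_apply (MulAction.injective (g⁻¹ : Γ)) a (g • x)
  simpa using this.symm

theorem exists_addChar_zmod_injective {p : ℕ} [Fact p.Prime] {C : Type*} [Field C] {ζ : C}
    (hζ : IsPrimitiveRoot ζ p) : ∃ e : AddChar (ZMod p) Cˣ, Function.Injective e ∧
      ∀ u : Cˣ, u ^ p = 1 → ∃ a, u = e a := by
  have : NeZero p := ⟨(Fact.out : p.Prime).ne_zero⟩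
  obtain ⟨ξ, hξ⟩ := hζ.isUnit (NeZero.ne p)
  rw [← hξ, IsPrimitiveRoot.coe_units_iff] at hζ
  refine ⟨AddChar.zmodChar p hζ.pow_eq_one, fun a b hab => ?_, fun u hu => ?_⟩
  · rw [AddChar.zmodChar_apply, AddChar.zmodChar_apply] at hab
    exact ZMod.val_injective p (hζ.pow_inj (ZMod.val_lt _) (ZMod.val_lt _) hab)
  · obtain ⟨i, hi, h⟩ := (IsPrimitiveRoot.coe_units_iff.2 hζ).eq_pow_of_pow_eq_one
      (ξ := (u : C)) (by rw [← Units.val_pow_eq_pow_val, hu, Units.val_one])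
    exact ⟨i, Units.ext (by rw [AddChar.zmodChar_apply, ZMod.val_natCast_of_lt hi, ← h]; rfl)⟩

/-- A group acting compatibly on a factorial ring and on an algebraically closed field, whose
kernel `H` satisfies Kummer theory, has no lift along `π` of a representation hitting elementary
matrices generating a Heisenberg group. -/
theorem false_of_lift {p : ℕ} [Fact p.Prime] (hodd : Odd p) {C R Ω Γ X : Type*} [Field C]
    [CommRing R] [IsDomain R] [UniqueFactorizationMonoid R] [Algebra C R] [Field Ω] [IsAlgClosed Ω]
    [Algebra C Ω] [Algebra R Ω] [IsScalarTower C R Ω] [FaithfulSMul R Ω] [Group Γ]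
    [MulSemiringAction Γ R] [MulSemiringAction Γ Ω] [SMulCommClass Γ C Ω] [MulAction Γ X]
    {ζ : C} (hζ : IsPrimitiveRoot ζ p) (hroot : ∀ c : C, ∃ d, d ^ p = c)
    (hunit : ∀ u : Rˣ, ∃ c : C, (u : R) = algebraMap C R c)
    (hequiv : ∀ (g : Γ) (r : R), g • algebraMap R Ω r = algebraMap R Ω (g • r))
    {H : Subgroup Γ} [H.Normal] (hH : ∀ h ∈ H, ∀ r : R, h • r = r)
    (hfix : ∀ x : Ω, (∀ h ∈ H, h • x = x) → ∃ e : ℕ, p.Coprime e ∧ ∃ a b : R, b ≠ 0 ∧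
      x ^ e * algebraMap R Ω b = algebraMap R Ω a)
    {rep : X → R} (hrep : ∀ x, Irreducible (rep x))
    (hsmul : ∀ (g : Γ) x, Associated (rep (g • x)) (g • rep x))
    (hsurj : ∀ a : R, Irreducible a → ∃ x, Associated (rep x) a)
    (hinj : ∀ x y, Associated (rep x) (rep y) → x = y)
    (hfin : ∀ x : X, (MulAction.orbit Γ x).Finite)
    {A k ι : Type*} [CommRing A] [CommRing k] {π : A →+* k} [Fintype ι] [DecidableEq ι]
    (hI : ∀ x y, π x = 0 → π y = 0 → x * y = 0) (hp : π p = 0) (hp0 : (p : A) ≠ 0)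
    (ρ : Γ →* GL ι A) (hρH : ∀ h ∈ H, (ρ h : Matrix ι ι A).map π = 1)
    {i₁ i₂ i₃ : ι} (h12 : i₁ ≠ i₂) (h23 : i₂ ≠ i₃) (h13 : i₁ ≠ i₃) {s t z : Γ}
    (hs : (ρ s : Matrix ι ι A).map π = transvection i₁ i₂ 1)
    (ht : (ρ t : Matrix ι ι A).map π = transvection i₂ i₃ 1)
    (hz : (ρ z : Matrix ι ι A).map π = transvection i₁ i₃ 1)
    (hst : s * t = z * (t * s)) (hsH : s ^ p ∈ H) (htH : t ^ p ∈ H) (hzH : z ^ p ∈ H)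
    (hzs : ∃ h ∈ H, z * s = s * z * h) (hzt : ∃ h ∈ H, z * t = t * z * h)
    (hkummer : ∀ χ : Γ → C, (∀ h ∈ H, χ h ≠ 0) → (∀ g ∈ H, ∀ h ∈ H, χ (g * h) = χ g * χ h) →
      (∀ h ∈ H, ρ h = 1 → χ h = 1) →
      ∃ β : Ω, β ≠ 0 ∧ ∀ h ∈ H, h • β = algebraMap C Ω (χ h) * β) : False := by
  classical
  obtain ⟨l, hl, hlp⟩ := exists_functional_natCast_eq_one hI hp hp0
  obtain ⟨e, he, hes⟩ := exists_addChar_zmod_injective hζ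
  choose θ hθ using fun x => IsAlgClosed.exists_pow_nat_eq (algebraMap R Ω (rep x))
    (Fact.out : p.Prime).pos
  obtain ⟨c, hc, hcoc⟩ := exists_cocycle hζ hroot hunit hequiv hrep hsmul hθ
  have hHX : ∀ h ∈ H, ∀ x : X, h • x = x := fun h hh x =>
    smul_eq_of_acts_trivially hH hinj hsmul hh x
  have hHc : ∀ h ∈ H, ∀ x, c h x ^ p = 1 := fun h hh x =>
    cocycle_pow_eq_one hequiv hH hHX hθ hrep hc hh x
  have hm : ∃ m : Γ → X → ZMod p, ∀ h ∈ H, ∀ x, c h x = e (m h x) := by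
    have h1 : ∀ (h : Γ) x, ∃ a, h ∈ H → c h x = e a := fun h x => by
      by_cases hh : h ∈ H
      · obtain ⟨a, ha⟩ := hes _ (hHc h hh x)
        exact ⟨a, fun _ => ha⟩
      · exact ⟨0, fun h => (hh h).elim⟩
    choose m hm using h1
    exact ⟨m, fun h hh x => hm h x hh⟩
  obtain ⟨m, hm⟩ := hm
  have huniq : ∀ a : X →₀ ZMod p,
      (∀ h ∈ H, Finsupp.linearCombination (ZMod p) (m h) a = 0) → a = 0 := fun a ha =>
    coefficients_unique hHX hfix hrep hinj hθ hc hm ha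
  obtain ⟨N, hN⟩ : ∃ N : Γ → Matrix ι ι A, ∀ h, N h = (ρ h : Matrix ι ι A) - 1 := ⟨_, fun _ => rfl⟩
  have hker : ∀ h ∈ H, ∀ i j, π (N h i j) = 0 := by
    intro h hh i j
    have := congrFun₂ (hρH h hh) i j
    rw [Matrix.map_apply] at this
    rw [hN, Matrix.sub_apply, map_sub, this]
    by_cases hij : i = j <;> simp [Matrix.one_apply, hij]
  have hlsub : ∀ x y, π x = 0 → π y = 0 → l (x - y) = l x - l y := by
    intro x y hx hy
    rw [eq_sub_iff_add_eq, ← hl _ _ (by rw [map_sub, hx, hy, sub_zero]) hy, sub_add_cancel]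
  have hl0 : l 0 = 0 := by simpa using hl 0 0 (map_zero π) (map_zero π)
  set f : ι → ι → Γ → ZMod p := fun i j h => l (N h i j) with hf
  have hcoef : ∀ i j, ∃ a : X →₀ ZMod p,
      ∀ h ∈ H, f i j h = Finsupp.linearCombination (ZMod p) (m h) a := by
    intro i j
    obtain ⟨β, hβ, hχ⟩ := hkummer (fun h => e (f i j h)) (fun h _ => Units.ne_zero _)
      (fun g hg h hh => by
        rw [← Units.val_mul, ← AddChar.map_add_eq_mul, hf]
        simp only
        rw [hN, map_mul, Units.val_mul, mul_sub_one_entry hI (hρH g hg) (hρH h hh), Matrix.add_apply,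
          ← hN, ← hN, hl _ _ (hker g hg i j) (hker h hh i j)])
      (fun h _ h1 => by simp [hf, hN, h1, hl0])
    exact exists_coefficients hζ hroot hunit hHX hequiv hH hfix hrep hsurj hθ hc he hm hβ hχ
  choose a ha using hcoef
  have hconj : ∀ {i j : ι}, i ≠ j → ∀ {g : Γ}, (ρ g : Matrix ι ι A).map π = transvection i j 1 →
      ∀ h ∈ H, ∀ i' j', N (g * h * g⁻¹) i' j' =
        N h i' j' + (if i' = i then N h j j' else 0)
        - (if j' = j then N h i' i else 0)
        - (if i' = i then if j' = j then N h j i else 0 else 0) := by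
    intro i j hij g hg h hh i' j'
    rw [hN, hN]
    refine conj_transvection_entry hI hij hg (hρH h hh)
      (hρH _ (Subgroup.Normal.conj_mem ‹_› h hh g)) ?_ i' j'
    rw [← Units.val_mul, ← Units.val_mul, ← map_mul, ← map_mul, inv_mul_cancel_right]
  have key := fun (χ : Γ → ZMod p) (b : X →₀ ZMod p)
    (hb : ∀ h ∈ H, χ h = Finsupp.linearCombination (ZMod p) (m h) b) (g : Γ) (b' : X →₀ ZMod p)
    (hb' : ∀ h ∈ H, χ (g * h * g⁻¹) = Finsupp.linearCombination (ZMod p) (m h) b') (x : X) =>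
    apply_smul_of_conj hcoc hHX he hm huniq hb g hb' x
  set S : Finset X := ((a i₁ i₃).support.finite_toSet.biUnion fun x _ => hfin x).toFinset with hS
  have hsum := sum_mul_eq_zero_of_cocycle hodd hcoc hHX hHc hst hsH htH hzH hzs hzt e he
    (μ := m (z ^ p)) (φ := a i₁ i₃) (α := a i₁ i₂) (β := a i₂ i₃)
    (η := (a i₃ i₃ - a i₁ i₁ : X →₀ ZMod p)) (ψ := a i₃ i₁) (hm _ hzH)
    (key _ _ (ha i₁ i₃) s (a i₁ i₃ + a i₂ i₃) fun h hh => by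
      rw [map_add, ← ha _ _ h hh, ← ha _ _ h hh]
      simp [hf, hconj h12 hs h hh, h23.symm, hl, hker h hh])
    (key _ _ (ha i₂ i₃) s (a i₂ i₃) fun h hh => by
      rw [← ha _ _ h hh]
      simp [hf, hconj h12 hs h hh, h23.symm, h12.symm])
    (key _ _ (ha i₁ i₃) t (a i₁ i₃ - a i₁ i₂) fun h hh => by
      rw [map_sub, ← ha _ _ h hh, ← ha _ _ h hh]
      simp [hf, hconj h23 ht h hh, h12, hlsub, hker h hh])
    (key _ _ (ha i₁ i₂) t (a i₁ i₂) fun h hh => by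
      rw [← ha _ _ h hh]
      simp [hf, hconj h23 ht h hh, h23, h12])
    (key _ _ (ha i₁ i₃) z (a i₁ i₃ + (a i₃ i₃ - a i₁ i₁) - a i₃ i₁) fun h hh => by
      rw [map_sub, map_add, map_sub, ← ha _ _ h hh, ← ha _ _ h hh, ← ha _ _ h hh, ← ha _ _ h hh]
      simp [hf, hconj h13 hz h hh, hl, hlsub, hker h hh]
      ring)
    (key (f i₃ i₃ - f i₁ i₁) (a i₃ i₃ - a i₁ i₁) (fun h hh => by
      rw [map_sub, ← ha _ _ h hh, ← ha _ _ h hh]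
      rfl) z (a i₃ i₃ - a i₁ i₁ - (2 : ZMod p) • a i₃ i₁)
      fun h hh => by
      rw [map_sub, map_sub, map_smul, ← ha _ _ h hh, ← ha _ _ h hh, ← ha _ _ h hh]
      simp [hf, hconj h13 hz h hh, hl, hlsub, hker h hh, h13, h13.symm]
      ring)
    (key _ _ (ha i₃ i₁) s (a i₃ i₁) fun h hh => by
      rw [← ha _ _ h hh]
      simp [hf, hconj h12 hs h hh, h13.symm, h12])
    (key _ _ (ha i₃ i₁) t (a i₃ i₁) fun h hh => by
      rw [← ha _ _ h hh]
      simp [hf, hconj h23 ht h hh, h13, h23.symm])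
    (key _ _ (ha i₃ i₁) z (a i₃ i₁) fun h hh => by
      rw [← ha _ _ h hh]
      simp [hf, hconj h13 hz h hh, h13, h13.symm])
    S (fun g x hx => by
      simp only [hS, Set.Finite.mem_toFinset, Set.mem_iUnion] at hx ⊢
      obtain ⟨y, hy, hxy⟩ := hx
      exact ⟨y, hy, (MulAction.orbit_eq_iff.2 hxy) ▸ MulAction.mem_orbit x g⟩)
  have h1 := ha i₁ i₃ _ hzH
  rw [Finsupp.linearCombination_apply, Finsupp.sum_of_support_subset (s := S) _ (fun x hx => by
    simp only [hS, Set.Finite.mem_toFinset, Set.mem_iUnion]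
    exact ⟨x, hx, MulAction.mem_orbit_self x⟩) _ (by simp)] at h1
  simp only [smul_eq_mul, mul_comm (a i₁ i₃ _), hsum, hf] at h1
  rw [hN, map_pow, Units.val_pow_eq_pow_val, pow_prime_sub_one_entry hodd hp hI h12 h23 h13 hs ht hz
    (by rw [← Units.val_mul, ← Units.val_mul, ← Units.val_mul, ← map_mul, ← map_mul, ← map_mul,
      hst]), hlp] at h1
  exact one_ne_zero h1

/-- An element of an algebraically closed algebraic extension fixed by all automorphisms is purely
inseparable over the base. -/
theorem exists_pow_mem_range_of_fixed {N Ω : Type*} [Field N] [Field Ω] [Algebra N Ω]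
    [IsAlgClosed Ω] [Algebra.IsAlgebraic N Ω] (q : ℕ) [ExpChar N q] {x : Ω}
    (hx : ∀ σ : Ω ≃ₐ[N] Ω, σ x = x) : ∃ n, x ^ q ^ n ∈ (algebraMap N Ω).range := by
  classical
  have : IsAlgClosure N Ω := ⟨inferInstance, inferInstance⟩
  have : Normal N Ω := IsAlgClosure.normal N Ω
  have hint : IsIntegral N x := Algebra.IsIntegral.isIntegral x
  rw [← minpoly.natSepDegree_eq_one_iff_pow_mem, Polynomial.natSepDegree_eq_of_isAlgClosed Ω,
    Finset.card_eq_one]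
  refine ⟨x, Finset.eq_singleton_iff_unique_mem.2 ⟨?_, fun y hy => ?_⟩⟩
  · rw [Multiset.mem_toFinset, Polynomial.mem_aroots]
    exact ⟨minpoly.ne_zero hint, minpoly.aeval N x⟩
  · rw [Multiset.mem_toFinset, Polynomial.mem_aroots] at hy
    obtain ⟨σ, hσ⟩ := minpoly.exists_algEquiv_of_root' (Algebra.IsAlgebraic.isAlgebraic x) hy.2
    rw [← hσ, hx]

/-- A finite-order character of a subgroup of a Galois group, with values in the base field, has a
nonzero eigenvector. -/
theorem exists_eigenvector {K Ω : Type*} [Field K] [Field Ω] [Algebra K Ω]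
    (E : IntermediateField K Ω) [FiniteDimensional K E] (H : Subgroup (Ω ≃ₐ[K] Ω)) (χ : (Ω ≃ₐ[K] Ω) → K)
    (hχ0 : ∀ h ∈ H, χ h ≠ 0) (hmul : ∀ g ∈ H, ∀ h ∈ H, χ (g * h) = χ g * χ h)
    (hχ1 : ∀ h ∈ H, h ∈ E.fixingSubgroup → χ h = 1) :
    ∃ β : Ω, β ≠ 0 ∧ ∀ h ∈ H, h β = algebraMap K Ω (χ h) * β := by
  classical
  have hext : ∀ g ∈ H, ∀ h ∈ H, g.toAlgHom.comp E.val = h.toAlgHom.comp E.val → χ g = χ h := by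
    intro g hg h hh hgh
    have hu : h⁻¹ * g ∈ H := H.mul_mem (H.inv_mem hh) hg
    have h1 : χ (h⁻¹ * g) = 1 := hχ1 _ hu fun x => by
      have := DFunLike.congr_fun hgh x
      change h.symm (g x) = x
      rw [AlgEquiv.symm_apply_eq]
      exact this
    have := hmul h hh _ hu
    rwa [mul_inv_cancel_left, h1, mul_one] at this
  have h0 : ∀ φ : E →ₐ[K] Ω, ∃ v : K, (∀ g ∈ H, φ = g.toAlgHom.comp E.val → v = (χ g)⁻¹) ∧
      ((¬ ∃ g ∈ H, φ = g.toAlgHom.comp E.val) → v = 0) := fun φ => by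
    by_cases h : ∃ g ∈ H, φ = g.toAlgHom.comp E.val
    · obtain ⟨g, hg, rfl⟩ := h
      exact ⟨(χ g)⁻¹, fun h hh hgh => by rw [hext g hg h hh hgh], fun h => (h ⟨g, hg, rfl⟩).elim⟩
    · exact ⟨0, fun g hg hφ => (h ⟨g, hg, hφ⟩).elim, fun _ => rfl⟩
  choose v hv hv0 using h0
  have hvmul : ∀ h ∈ H, ∀ φ, v φ = χ h * v (h.toAlgHom.comp φ) := by
    intro h hh φ
    by_cases hφ : ∃ g ∈ H, φ = g.toAlgHom.comp E.val
    · obtain ⟨g, hg, hφ⟩ := hφ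
      rw [hv φ g hg hφ, hv (h.toAlgHom.comp φ) (h * g) (H.mul_mem hh hg) (by rw [hφ]; rfl),
        hmul h hh g hg, mul_inv, mul_inv_cancel_left₀ (hχ0 h hh)]
    · rw [hv0 φ hφ, hv0 (h.toAlgHom.comp φ), mul_zero]
      rintro ⟨g, hg, hg'⟩
      refine hφ ⟨h⁻¹ * g, H.mul_mem (H.inv_mem hh) hg, ?_⟩
      ext x
      have := DFunLike.congr_fun hg' x
      change φ x = h.symm (g x)
      rw [AlgEquiv.eq_symm_apply]
      exact this
  have hind : LinearIndependent Ω fun φ : E →ₐ[K] Ω => (φ : E → Ω) :=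
    (linearIndependent_monoidHom E Ω).comp (fun φ : E →ₐ[K] Ω => (φ : E →* Ω)) fun φ ψ h => by
      ext x
      exact DFunLike.congr_fun h x
  have hne : ∑ φ : E →ₐ[K] Ω, algebraMap K Ω (v φ) • (φ : E → Ω) ≠ 0 := fun h => by
    have := Fintype.linearIndependent_iff.1 hind _ h E.val
    rw [map_eq_zero, hv E.val 1 H.one_mem rfl, inv_eq_zero] at this
    exact hχ0 1 H.one_mem this
  obtain ⟨y, hy⟩ := Function.ne_iff.1 hne
  refine ⟨_, hy, fun h hh => ?_⟩
  simp only [Finset.sum_apply, Pi.smul_apply, smul_eq_mul, map_sum, map_mul, AlgEquiv.commutes,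
    Finset.mul_sum]
  refine Fintype.sum_bijective (fun φ => h.toAlgHom.comp φ) ?_ _ _ fun φ => ?_
  · refine Function.bijective_iff_has_inverse.2 ⟨fun φ => h.symm.toAlgHom.comp φ, fun φ => ?_,
      fun φ => ?_⟩ <;> ext x <;> simp
  · rw [hvmul h hh φ, map_mul, mul_assoc]
    rfl

/-- A group acting on a domain acts on the classes of irreducible elements up to units. -/
theorem exists_mulAction_irreducible.{u, v} {W : Type u} {R : Type v} [Group W] [CommRing R]
    [IsDomain R] [MulSemiringAction W R] : ∃ (X : Type v) (_ : MulAction W X) (rep : X → R),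
      (∀ x, Irreducible (rep x)) ∧ (∀ (w : W) x, Associated (rep (w • x)) (w • rep x)) ∧
      (∀ a : R, Irreducible a → ∃ x, Associated (rep x) a) ∧
      ∀ x y, Associated (rep x) (rep y) → x = y := by
  have hirr : ∀ (w : W) {a : R}, Irreducible a → Irreducible (w • a) := fun w a ha =>
    (MulEquiv.irreducible_iff (MulSemiringAction.toRingEquiv W R w)).2 ha
  have hass : ∀ (w : W) {a b : R}, Associated a b → Associated (w • a) (w • b) := fun w a b h =>
    h.map (MulSemiringAction.toRingHom W R w)
  let rep : {a : Associates R // Irreducible a} → R := fun x => Quotient.out x.1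
  have hmk : ∀ x, Associates.mk (rep x) = x.1 := fun x => Associates.quot_out x.1
  have hrep : ∀ x, Irreducible (rep x) := fun x =>
    Associates.irreducible_mk.1 ((hmk x).symm ▸ x.2)
  let act : W → {a : Associates R // Irreducible a} → {a : Associates R // Irreducible a} :=
    fun w x => ⟨Associates.mk (w • rep x), Associates.irreducible_mk.2 (hirr w (hrep x))⟩
  have hact : ∀ w x, Associated (rep (act w x)) (w • rep x) := fun w x =>
    Associates.mk_eq_mk_iff_associated.1 (hmk (act w x))
  refine ⟨{a : Associates R // Irreducible a},
    { smul := act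
      one_smul := fun x => Subtype.ext ?_
      mul_smul := fun w w' x => Subtype.ext ?_ }, rep, hrep, hact, fun a ha => ?_, fun x y h => ?_⟩
  · change Associates.mk ((w * w') • rep x) = Associates.mk (w • rep (act w' x))
    rw [Associates.mk_eq_mk_iff_associated, mul_smul]
    exact hass w (hact w' x).symm
  · change Associates.mk ((1 : W) • rep x) = x.1
    rw [one_smul, hmk]
  · exact ⟨⟨Associates.mk a, Associates.irreducible_mk.2 ha⟩,
      Associates.mk_eq_mk_iff_associated.1 (hmk _)⟩
  · exact Subtype.ext (by rw [← hmk, ← hmk, Associates.mk_eq_mk_iff_associated.2 h])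

/-- The Galois-theoretic form of `false_of_lift`. -/
theorem not_exists_lift {p : ℕ} [Fact p.Prime] (hodd : Odd p) {C K R N Ω W : Type*} [Field C]
    [IsAlgClosed C] (hpC : (p : C) ≠ 0) [Field K] [Algebra C K] [CommRing R] [IsDomain R]
    [UniqueFactorizationMonoid R] [Algebra C R] [Field N] [Algebra R N] [IsFractionRing R N]
    [Algebra K N] [Field Ω] [IsAlgClosed Ω] [Algebra K Ω] [Algebra.IsAlgebraic K Ω] [Algebra C Ω]
    [IsScalarTower C K Ω] [Algebra R Ω] [IsScalarTower C R Ω] [FaithfulSMul R Ω] [Algebra N Ω]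
    [IsScalarTower K N Ω] [IsScalarTower R N Ω] [Group W] [Finite W] [MulSemiringAction W R]
    [FaithfulSMul W R] (hunit : ∀ u : Rˣ, ∃ c : C, (u : R) = algebraMap C R c)
    {res : (Ω ≃ₐ[K] Ω) →* W} (hres : Function.Surjective res)
    (hequiv : ∀ g r, g (algebraMap R Ω r) = algebraMap R Ω (res g • r))
    {A k ι : Type*} [CommRing A] [CommRing k] {π : A →+* k} [Fintype ι] [DecidableEq ι]
    (hI : ∀ x y, π x = 0 → π y = 0 → x * y = 0) (hp : π p = 0) (hp0 : (p : A) ≠ 0)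
    {f : W →* GL ι k} {u v w : W} {i₁ i₂ i₃ : ι} (h12 : i₁ ≠ i₂) (h23 : i₂ ≠ i₃) (h13 : i₁ ≠ i₃)
    (hu : (f u : Matrix ι ι k) = transvection i₁ i₂ 1)
    (hv : (f v : Matrix ι ι k) = transvection i₂ i₃ 1)
    (hw : (f w : Matrix ι ι k) = transvection i₁ i₃ 1) (huv : u * v = w * (v * u))
    (hup : u ^ p = 1) (hvp : v ^ p = 1) (hwp : w ^ p = 1) (hwu : w * u = u * w)
    (hwv : w * v = v * w) (ρ : (Ω ≃ₐ[K] Ω) →* GL ι A) (E : IntermediateField K Ω)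
    [FiniteDimensional K E] (hE : E.fixingSubgroup ≤ ρ.ker)
    (hlift : (Matrix.GeneralLinearGroup.map π).comp ρ = f.comp res) : False := by
  have hred : ∀ g, (ρ g : Matrix ι ι A).map π = (f (res g) : Matrix ι ι k) := fun g =>
    congrArg Units.val (DFunLike.congr_fun hlift g)
  obtain ⟨X, instX, rep, hrep, hsmul, hsurj, hinj⟩ := exists_mulAction_irreducible (W := W) (R := R)
  let : MulSemiringAction (Ω ≃ₐ[K] Ω) R := MulSemiringAction.compHom R res
  let : MulAction (Ω ≃ₐ[K] Ω) X := MulAction.compHom X res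
  have : SMulCommClass (Ω ≃ₐ[K] Ω) C Ω := ⟨fun g c x => by
    rw [AlgEquiv.smul_def, AlgEquiv.smul_def, ← algebraMap_smul K c x, map_smul, algebraMap_smul]⟩
  have : NeZero (p : C) := ⟨hpC⟩
  obtain ⟨ζ, hζ⟩ := HasEnoughRootsOfUnity.exists_primitiveRoot C p
  obtain ⟨s, rfl⟩ := hres u
  obtain ⟨t, rfl⟩ := hres v
  obtain ⟨z, hst, rfl⟩ : ∃ z, s * t = z * (t * s) ∧ res z = w :=
    ⟨s * t * (t * s)⁻¹, (inv_mul_cancel_right _ _).symm, by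
      rw [map_mul, map_inv, map_mul, map_mul, huv, mul_inv_cancel_right]⟩
  refine false_of_lift hodd hζ (fun c => IsAlgClosed.exists_pow_nat_eq c (Fact.out : p.Prime).pos)
    hunit hequiv (H := res.ker) (fun h hh r => ?_) ?_ hrep (fun g x => hsmul (res g) x) hsurj hinj
    (fun x => (Set.finite_range fun y : W => y • x).subset ?_) hI hp hp0 ρ (fun h hh => ?_)
    h12 h23 h13 (by rw [hred, hu]) (by rw [hred, hv]) (by rw [hred, hw]) hst
    (by rw [MonoidHom.mem_ker, map_pow, hup]) (by rw [MonoidHom.mem_ker, map_pow, hvp])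
    (by rw [MonoidHom.mem_ker, map_pow, hwp]) ⟨(s * z)⁻¹ * (z * s), ?_, by group⟩
    ⟨(t * z)⁻¹ * (z * t), ?_, by group⟩ fun χ hχ0 hχ hχ1 => ?_
  · change res h • r = r
    rw [MonoidHom.mem_ker.1 hh, one_smul]
  · intro x hx
    obtain ⟨q, hq⟩ := ExpChar.exists C
    have : ExpChar R q := expChar_of_injective_algebraMap (algebraMap C R).injective q
    have : ExpChar N q := expChar_of_injective_algebraMap (IsFractionRing.injective R N) q
    have : Algebra.IsAlgebraic N Ω := Algebra.IsAlgebraic.tower_top (K := K) N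
    obtain ⟨n, y, hy⟩ := exists_pow_mem_range_of_fixed (N := N) q (x := x) fun σ =>
      hx (σ.restrictScalars K) <| MonoidHom.mem_ker.2 <| eq_of_smul_eq_smul fun r : R => by
        apply FaithfulSMul.algebraMap_injective R Ω
        rw [one_smul, ← hequiv, IsScalarTower.algebraMap_apply R N Ω]
        exact σ.commutes _
    obtain ⟨a, b, hb, rfl⟩ := IsFractionRing.div_surjective (A := R) y
    have hb0 : algebraMap R N b ≠ 0 := by
      rw [Ne, IsFractionRing.to_map_eq_zero_iff]
      exact nonZeroDivisors.ne_zero hb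
    refine ⟨q ^ n, Nat.Coprime.pow_right n ?_, a, b, nonZeroDivisors.ne_zero hb, ?_⟩
    · rcases hq with _ | hq'
      · exact Nat.coprime_one_right p
      · exact (Nat.coprime_primes Fact.out hq').2 fun h => hpC (by rw [h, CharP.cast_eq_zero])
    · rw [← hy, IsScalarTower.algebraMap_apply R N Ω, ← map_mul, div_mul_cancel₀ _ hb0,
        ← IsScalarTower.algebraMap_apply]
  · rintro _ ⟨g, rfl⟩
    exact ⟨res g, rfl⟩
  · rw [hred, MonoidHom.mem_ker.1 hh, map_one, Units.val_one]
  · rw [MonoidHom.mem_ker]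
    simp only [map_mul, map_inv, hwu, inv_mul_cancel]
  · rw [MonoidHom.mem_ker]
    simp only [map_mul, map_inv, hwv, inv_mul_cancel]
  · obtain ⟨β, hβ, h⟩ := exists_eigenvector E res.ker (fun g => algebraMap C K (χ g))
      (fun h hh => (map_ne_zero _).2 (hχ0 h hh)) (fun g hg h hh => by rw [hχ g hg h hh, map_mul])
      (fun h hh hhE => by rw [hχ1 h hh (hE hhE), map_one])
    exact ⟨β, hβ, fun g hg => by
      rw [IsScalarTower.algebraMap_apply C K Ω]
      exact h g hg⟩

/-- A homomorphism from an absolute Galois group to a discrete group is continuous iff it factors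
through a finite extension. -/
theorem continuous_bot_iff {K G : Type*} [Field K] [Group G]
    (ρ : Field.absoluteGaloisGroup K →* G) :
    Continuous[_, ⊥] ⇑ρ ↔ ∃ E : IntermediateField K (AlgebraicClosure K),
      FiniteDimensional K E ∧ E.fixingSubgroup ≤ ρ.ker := by
  let : TopologicalSpace G := ⊥
  have : DiscreteTopology G := ⟨rfl⟩
  suffices Continuous ρ ↔ (ρ.ker : Set (Field.absoluteGaloisGroup K)) ∈ 𝓝 1 from
    this.trans (krullTopology_mem_nhds_one_iff K (AlgebraicClosure K) _)
  refine ⟨fun h => ((isOpen_discrete ({1} : Set G)).preimage h).mem_nhds (map_one ρ), fun h => ?_⟩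
  refine continuous_of_continuousAt_one ρ ?_
  rw [ContinuousAt, map_one, nhds_discrete G, Filter.tendsto_pure]
  exact h

/-- The action of `W` on polynomials in variables indexed by `W`, by left translation of the
variables. -/
@[reducible] noncomputable def MvPolynomial.translationAction (W C : Type*) [Group W]
    [CommRing C] : MulSemiringAction W (MvPolynomial W C) where
  smul w P := MvPolynomial.rename (w * ·) P
  one_smul P := by
    change MvPolynomial.rename ((1 : W) * ·) P = P
    simp only [one_mul]
    exact MvPolynomial.rename_id_apply P
  mul_smul w w' P := by
    change MvPolynomial.rename (w * w' * ·) P =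
      MvPolynomial.rename (w * ·) (MvPolynomial.rename (w' * ·) P)
    rw [MvPolynomial.rename_rename]
    congr 2
    funext x
    exact mul_assoc w w' x
  smul_zero _ := map_zero _
  smul_add _ := map_add _
  smul_one _ := map_one _
  smul_mul _ := map_mul _

theorem exists_hom_of_galois {p : ℕ} [Fact p.Prime] (hodd : Odd p) {C K R N W : Type*} [Field C]
    [IsAlgClosed C] (hpC : (p : C) ≠ 0) [Field K] [Algebra C K] [CommRing R] [IsDomain R]
    [UniqueFactorizationMonoid R] [Algebra C R] [Field N] [Algebra R N] [IsFractionRing R N]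
    [Algebra C N] [IsScalarTower C R N] [Algebra K N] [IsScalarTower C K N] [FiniteDimensional K N]
    [Normal K N] [Group W] [Finite W] [MulSemiringAction W R] [FaithfulSMul W R]
    (hunit : ∀ u : Rˣ, ∃ c : C, (u : R) = algebraMap C R c) (e : W ≃* (N ≃ₐ[K] N))
    (he : ∀ w (r : R), e w (algebraMap R N r) = algebraMap R N (w • r))
    {A k ι : Type*} [CommRing A] [CommRing k] {π : A →+* k} [Fintype ι] [DecidableEq ι]
    (hI : ∀ x y, π x = 0 → π y = 0 → x * y = 0) (hp : π p = 0) (hp0 : (p : A) ≠ 0)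
    {f : W →* GL ι k} {u v w : W} {i₁ i₂ i₃ : ι} (h12 : i₁ ≠ i₂) (h23 : i₂ ≠ i₃) (h13 : i₁ ≠ i₃)
    (hu : (f u : Matrix ι ι k) = transvection i₁ i₂ 1)
    (hv : (f v : Matrix ι ι k) = transvection i₂ i₃ 1)
    (hw : (f w : Matrix ι ι k) = transvection i₁ i₃ 1) (huv : u * v = w * (v * u))
    (hup : u ^ p = 1) (hvp : v ^ p = 1) (hwp : w ^ p = 1) (hwu : w * u = u * w)
    (hwv : w * v = v * w) :
    ∃ φ : Field.absoluteGaloisGroup K →* W, Continuous[_, ⊥] ⇑φ ∧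
      ∀ ρ : Field.absoluteGaloisGroup K →* GL ι A, Continuous[_, ⊥] ⇑ρ →
        (Matrix.GeneralLinearGroup.map π).comp ρ ≠ f.comp φ := by
  let Ω := AlgebraicClosure K
  let j : N →ₐ[K] Ω := IsAlgClosed.lift
  let : Algebra N Ω := j.toRingHom.toAlgebra
  have : IsScalarTower K N Ω := IsScalarTower.of_algebraMap_eq fun x => (j.commutes x).symm
  let : Algebra R Ω := ((algebraMap N Ω).comp (algebraMap R N)).toAlgebra
  have : IsScalarTower R N Ω := IsScalarTower.of_algebraMap_eq fun _ => rfl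
  have : IsScalarTower C R Ω := IsScalarTower.of_algebraMap_eq fun c => by
    rw [IsScalarTower.algebraMap_apply C K Ω, IsScalarTower.algebraMap_apply K N Ω,
      IsScalarTower.algebraMap_apply R N Ω, ← IsScalarTower.algebraMap_apply C R N,
      ← IsScalarTower.algebraMap_apply C K N]
  have : FaithfulSMul R Ω := (faithfulSMul_iff_algebraMap_injective R Ω).2
    ((algebraMap N Ω).injective.comp (IsFractionRing.injective R N))
  let res : (Ω ≃ₐ[K] Ω) →* W := e.symm.toMonoidHom.comp (AlgEquiv.restrictNormalHom N)
  have hres : ∀ g, e (res g) = g.restrictNormal N := fun g => e.apply_symm_apply _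
  refine ⟨res, (continuous_bot_iff res).2 ⟨j.fieldRange, ?_, fun g hg => ?_⟩, fun ρ hρ hlift => ?_⟩
  · exact Module.Finite.of_surjective j.rangeRestrict.toLinearMap j.rangeRestrict_surjective
  · refine MonoidHom.mem_ker.2 (e.injective (AlgEquiv.ext fun x => j.injective ?_))
    rw [map_one, AlgEquiv.one_apply]
    exact (congrArg (fun σ : N ≃ₐ[K] N => j (σ x)) (hres g)).trans
      ((AlgEquiv.restrictNormal_commutes g N x).trans (hg ⟨j x, x, rfl⟩))
  · obtain ⟨E, hE, hEρ⟩ := (continuous_bot_iff ρ).1 hρ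
    refine not_exists_lift (K := K) (N := N) (Ω := Ω) hodd hpC hunit (res := res)
      (e.symm.surjective.comp (AlgEquiv.restrictNormalHom_surjective Ω)) (fun g r => ?_) hI hp hp0
      h12 h23 h13 hu hv hw huv hup hvp hwp hwu hwv ρ E hEρ hlift
    rw [IsScalarTower.algebraMap_apply R N Ω, IsScalarTower.algebraMap_apply R N Ω, ← he, hres]
    exact (AlgEquiv.restrictNormal_commutes g N _).symm

theorem exists_hom_absoluteGaloisGroup_not_lift.{u} {p : ℕ} [Fact p.Prime] (hodd : Odd p)
    (F : Type u) [Field F] (hpF : (p : F) ≠ 0) {W : Type u} [Group W] [Finite W]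
    {A k ι : Type*} [CommRing A] [CommRing k] {π : A →+* k} [Fintype ι] [DecidableEq ι]
    (hI : ∀ x y, π x = 0 → π y = 0 → x * y = 0) (hp : π p = 0) (hp0 : (p : A) ≠ 0)
    {f : W →* GL ι k} {u v w : W} {i₁ i₂ i₃ : ι} (h12 : i₁ ≠ i₂) (h23 : i₂ ≠ i₃) (h13 : i₁ ≠ i₃)
    (hu : (f u : Matrix ι ι k) = transvection i₁ i₂ 1)
    (hv : (f v : Matrix ι ι k) = transvection i₂ i₃ 1)
    (hw : (f w : Matrix ι ι k) = transvection i₁ i₃ 1) (huv : u * v = w * (v * u))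
    (hup : u ^ p = 1) (hvp : v ^ p = 1) (hwp : w ^ p = 1) (hwu : w * u = u * w)
    (hwv : w * v = v * w) :
    ∃ (K : Type u) (_ : Field K) (_ : Algebra F K) (φ : Field.absoluteGaloisGroup K →* W),
      Continuous[_, ⊥] ⇑φ ∧ ∀ ρ : Field.absoluteGaloisGroup K →* GL ι A, Continuous[_, ⊥] ⇑ρ →
        (Matrix.GeneralLinearGroup.map π).comp ρ ≠ f.comp φ := by
  let C := AlgebraicClosure F
  let R := MvPolynomial W C
  let N := FractionRing R
  let : MulSemiringAction W R := MvPolynomial.translationAction W C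
  have : FaithfulSMul W R := ⟨fun {w w'} h => by
    have h1 : MvPolynomial.rename (w * ·) (MvPolynomial.X (R := C) 1) =
        MvPolynomial.rename (w' * ·) (MvPolynomial.X 1) := h (MvPolynomial.X 1)
    rw [MvPolynomial.rename_X, MvPolynomial.rename_X, mul_one, mul_one] at h1
    exact MvPolynomial.X_injective h1⟩
  let : MulSemiringAction W N := IsFractionRing.mulSemiringAction W R N
  have : SMulDistribClass W R N := IsFractionRing.smulDistribClass W R N
  have : FaithfulSMul W N := IsFractionRing.faithfulSMul W R N
  have hRN : ∀ (w : W) (r : R), w • algebraMap R N r = algebraMap R N (w • r) := fun w r =>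
    (algebraMap.coe_smul' w r N).symm
  let K := FixedPoints.subfield W N
  let toK : C →+* K := (algebraMap C N).codRestrict K fun c w => by
    rw [IsScalarTower.algebraMap_apply C R N, hRN]
    exact congrArg _ (MvPolynomial.rename_C _ c)
  let : Algebra C K := toK.toAlgebra
  have : IsScalarTower C K N := IsScalarTower.of_algebraMap_eq fun _ => rfl
  obtain ⟨φ, hφ⟩ := exists_hom_of_galois (C := C) (K := K) (R := R) (N := N) hodd
    (by
      rw [← map_natCast (algebraMap F C)]
      exact (map_ne_zero _).2 hpF)
    (fun x => by
      obtain ⟨c, _, hc⟩ := MvPolynomial.isUnit_iff_eq_C_of_isReduced.1 x.isUnit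
      exact ⟨c, hc⟩)
    (FixedPoints.toAlgAutMulEquiv W N) hRN hI hp hp0 h12 h23 h13 hu hv hw huv hup hvp hwp hwu hwv
  exact ⟨K, inferInstance, (toK.comp (algebraMap F C)).toAlgebra, φ, hφ⟩

/-- Let `p` be an odd prime, `F` a field of characteristic `≠ p`, `k` a
field of characteristic `p`, and `n ≥ 3`. Then there exist a field extension `K/F` and a
continuous homomorphism `Γ_K → GL_n(k)` admitting no continuous lift to `GL_n(W₂(k))`. -/
theorem exists_nonliftable_odd_p (p : ℕ) [Fact p.Prime] (hodd : Odd p)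
    (F : Type) [Field F] (hF : ringChar F ≠ p)
    (k : Type) [Field k] [CharP k p] (n : ℕ) (hn : 3 ≤ n) :
    ∃ (K : Type) (instK : Field K),
      letI := instK
      ∃ (_ : Algebra F K) (ρ : Field.absoluteGaloisGroup K →* GL (Fin n) k),
        Continuous[_, ⊥] ⇑ρ ∧
          ¬ ∃ ρ' : Field.absoluteGaloisGroup K →* GL (Fin n) (TruncatedWittVector p 2 k),
              Continuous[_, ⊥] ⇑ρ' ∧
                (Matrix.GeneralLinearGroup.map (wittReduce p k)).comp ρ' = ρ := by
  have hpF : (p : F) ≠ 0 := fun h =>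
    ((Nat.dvd_prime Fact.out).1 (ringChar.dvd h)).elim CharP.ringChar_ne_one hF
  let i₁ : Fin n := ⟨0, by omega⟩
  let i₂ : Fin n := ⟨1, by omega⟩
  let i₃ : Fin n := ⟨2, by omega⟩
  have h12 : i₁ ≠ i₂ := by simp [i₁, i₂]
  have h23 : i₂ ≠ i₃ := by simp [i₂, i₃]
  have h13 : i₁ ≠ i₃ := by simp [i₁, i₃]
  let f : GL (Fin n) (ZMod p) →* GL (Fin n) k :=
    Matrix.GeneralLinearGroup.map (ZMod.castHom dvd_rfl k)
  have hf : ∀ {i j : Fin n} (h : i ≠ j),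
      (f (transvectionGL h) : Matrix (Fin n) (Fin n) k) = transvection i j 1 := fun h =>
    (map_transvection _ _ _ _).trans (by rw [map_one])
  obtain ⟨K, instK, instA, φ, hφ, hlift⟩ := exists_hom_absoluteGaloisGroup_not_lift
    (A := TruncatedWittVector p 2 k) (π := wittReduce p k) (f := f) hodd F hpF
    (TruncatedWittVector.mul_eq_zero_of_coeff_zero p k) (by rw [map_natCast, CharP.cast_eq_zero])
    (TruncatedWittVector.natCast_prime_ne_zero p k) h12 h23 h13 (hf h12) (hf h23) (hf h13)
    (Units.ext (transvection_commutator h23 h13)) (transvectionGL_pow_prime h12)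
    (transvectionGL_pow_prime h23) (transvectionGL_pow_prime h13)
    (Units.ext (transvection_mul_comm h13.symm h12.symm))
    (Units.ext (transvection_mul_comm h23.symm h13.symm))
  refine ⟨K, instK, instA, f.comp φ, ?_, fun ⟨ρ', hρ', h⟩ => hlift ρ' hρ' h⟩
  obtain ⟨E, hE, hEφ⟩ := (continuous_bot_iff φ).1 hφ
  exact (continuous_bot_iff _).2 ⟨E, hE, fun g hg => MonoidHom.mem_ker.2
    ((congrArg f (MonoidHom.mem_ker.1 (hEφ hg))).trans (map_one f))⟩
end

section
/- Let k be a field of characteristic p > 0 and n a positive integer. Let ι : M_n(k) → GL_n(W₂(k)) be the map sending a matrix M = (m_{ij}) to the invertible matrix I + (V(m_{ij})), where V : k → W₂(k) sends b ∈ k to the Witt vector with coefficients (0, b). For A ∈ GL_n(k), let A^{(p)} ∈ GL_n(k) be the matrix obtained by raising every entry of A to the p-th power. Then for every à ∈ GL_n(W₂(k)) with π(Ã) = A (entrywise) and every M ∈ M_n(k), one has à · ι(M) · Ã⁻¹ = ι(A^{(p)} M (A^{(p)})⁻¹). In other words, the conjugation action of GL_n(k) on the kernel of π : GL_n(W₂(k))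 → GL_n(k), identified with M_n(k) via ι, is given by (A, M) ↦ A^{(p)} M (A^{(p)})⁻¹. -/
open Matrix Topology

namespace TruncatedWittVector

variable {p : ℕ} [Fact p.Prime]

theorem mk_zero_coeff_eq_truncate_verschiebung {k : Type*} [CommRing k] (x : WittVector p k) :
    mk p ![0, x.coeff 0] = WittVector.truncate 2 (WittVector.verschiebung x) := by
  ext i
  rw [WittVector.coeff_truncate, coeff_mk]
  fin_cases i
  · exact (WittVector.verschiebung_coeff_zero x).symm
  · exact (WittVector.verschiebung_coeff_succ x 0).symm

variable (p) in
/-- The Verschiebung `b ↦ (0, b)` as an additive homomorphism from `k` to the Witt vectors of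
length `2`. -/
noncomputable def verschiebungTwo (k : Type*) [CommRing k] : k →+ TruncatedWittVector p 2 k :=
  AddMonoidHom.mk' (fun b => mk p ![0, b]) fun a b => by
    have h := mk_zero_coeff_eq_truncate_verschiebung
      (WittVector.teichmuller p a + WittVector.teichmuller p b)
    rw [WittVector.add_coeff_zero, _root_.map_add, _root_.map_add,
      ← mk_zero_coeff_eq_truncate_verschiebung,
      ← mk_zero_coeff_eq_truncate_verschiebung] at h
    simpa only [WittVector.teichmuller_coeff_zero] using h

theorem verschiebungTwo_apply {k : Type*} [CommRing k] (b : k) :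
    verschiebungTwo p k b = mk p ![0, b] :=
  rfl

variable {k : Type*} [CommRing k] [CharP k p]

theorem verschiebungTwo_mul (b : k) (y : TruncatedWittVector p 2 k) :
    verschiebungTwo p k b * y = verschiebungTwo p k (b * frobenius k p (wittReduce p k y)) := by
  obtain ⟨z, rfl⟩ := WittVector.truncate_surjective (p := p) 2 k y
  have hz : wittReduce p k (WittVector.truncate 2 z) = z.coeff 0 :=
    WittVector.coeff_truncate z 0
  have h := mk_zero_coeff_eq_truncate_verschiebung
    (WittVector.teichmuller p b * WittVector.frobenius z)
  rw [WittVector.verschiebung_mul_frobenius, _root_.map_mul,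
    ← mk_zero_coeff_eq_truncate_verschiebung, WittVector.mul_coeff_zero,
    WittVector.coeff_frobenius_charP, WittVector.teichmuller_coeff_zero] at h
  rw [hz, frobenius_def, verschiebungTwo_apply, verschiebungTwo_apply, h]

theorem mul_verschiebungTwo (b : k) (y : TruncatedWittVector p 2 k) :
    y * verschiebungTwo p k b = verschiebungTwo p k (frobenius k p (wittReduce p k y) * b) := by
  rw [mul_comm, verschiebungTwo_mul, mul_comm b]

variable {l m n : Type*} [Fintype m]

theorem map_verschiebungTwo_mul (N : Matrix l m k) (C : Matrix m n (TruncatedWittVector p 2 k)) :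
    N.map (verschiebungTwo p k) * C =
      (N * (C.map (wittReduce p k)).map (frobenius k p)).map (verschiebungTwo p k) := by
  ext1 i j
  simp only [Matrix.mul_apply, Matrix.map_apply, verschiebungTwo_mul, _root_.map_sum]

theorem mul_map_verschiebungTwo (C : Matrix l m (TruncatedWittVector p 2 k)) (N : Matrix m n k) :
    C * N.map (verschiebungTwo p k) =
      ((C.map (wittReduce p k)).map (frobenius k p) * N).map (verschiebungTwo p k) := by
  ext1 i j
  simp only [Matrix.mul_apply, Matrix.map_apply, mul_verschiebungTwo, _root_.map_sum]

end TruncatedWittVector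

/-- The conjugation action of `GL_n(k)` on the kernel of
`GL_n(W₂(k)) → GL_n(k)`, identified with `M_n(k)` via `M ↦ I + (V(m_{ij}))` where `V(b)`
is the Witt vector with coefficients `(0, b)`, is given by `(A, M) ↦ A⁽ᵖ⁾ M (A⁽ᵖ⁾)⁻¹`,
where `A⁽ᵖ⁾` is the entrywise `p`-th power (entrywise Frobenius) of `A`. -/
theorem conjugation_action_on_kernel
    (p : ℕ) [Fact p.Prime] (k : Type) [Field k] [CharP k p] (n : ℕ) (hn : 0 < n)
    (A : GL (Fin n) k) (B : GL (Fin n) (TruncatedWittVector p 2 k))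
    (hB : Matrix.GeneralLinearGroup.map (wittReduce p k) B = A)
    (M : Matrix (Fin n) (Fin n) k) :
    (B : Matrix (Fin n) (Fin n) (TruncatedWittVector p 2 k)) *
        (1 + Matrix.of fun i j => TruncatedWittVector.mk p ![0, M i j]) *
        ((B⁻¹ : GL (Fin n) (TruncatedWittVector p 2 k)) :
          Matrix (Fin n) (Fin n) (TruncatedWittVector p 2 k)) =
      1 + Matrix.of fun i j => TruncatedWittVector.mk p ![0,
        (((Matrix.GeneralLinearGroup.map (frobenius k p) A : GL (Fin n) k) :
            Matrix (Fin n) (Fin n) k) * M *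
          (((Matrix.GeneralLinearGroup.map (frobenius k p) A)⁻¹ : GL (Fin n) k) :
            Matrix (Fin n) (Fin n) k)) i j] := by
  change (B : Matrix (Fin n) (Fin n) (TruncatedWittVector p 2 k)) *
      (1 + M.map (TruncatedWittVector.verschiebungTwo p k)) * _ =
    1 + Matrix.map _ (TruncatedWittVector.verschiebungTwo p k)
  rw [mul_add, mul_one, add_mul, Units.mul_inv, TruncatedWittVector.mul_map_verschiebungTwo,
    TruncatedWittVector.map_verschiebungTwo_mul, ← hB, ← _root_.map_inv, ← _root_.map_inv]
  rfl
end

section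
/- Let F be a field, let k be a field of characteristic p > 0, and let n be a positive integer. Suppose that for every field extension K/F, every continuous homomorphism Γ_K → B_n(k) lifts to W₂(k), i.e. there is a continuous homomorphism Γ_K → B_n(W₂(k)) whose composite with π is the given one. Then for every field extension K/F, every continuous homomorphism Γ_K → GL_n(k) lifts to W₂(k), i.e. there is a continuous homomorphism Γ_K → GL_n(W₂(k)) whose composite with π is the given one. -/
open Matrix Topology

/-- `B_n(R)`: the Borel subgroup of `GL_n(R)` consisting of the invertible upper-triangular
`n × n` matrices over `R`. -/
def BorelSubgroup (n : ℕ) (R : Type*) [CommRing R] : Subgroup (GL (Fin n) R) where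
  carrier := {A | ((A : Matrix (Fin n) (Fin n) R)).BlockTriangular id}
  one_mem' := by
    show ((1 : GL (Fin n) R) : Matrix (Fin n) (Fin n) R).BlockTriangular id
    simpa using Matrix.blockTriangular_one
  mul_mem' := by
    intro A B hA hB
    show ((A * B : GL (Fin n) R) : Matrix (Fin n) (Fin n) R).BlockTriangular id
    simpa [Units.val_mul] using hA.mul hB
  inv_mem' := by
    intro A hA
    show ((A⁻¹ : GL (Fin n) R) : Matrix (Fin n) (Fin n) R).BlockTriangular id
    rw [Matrix.coe_units_inv]
    letI := A.invertible
    exact Matrix.blockTriangular_inv_of_blockTriangular hA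

/-- The group homomorphism `B_n(R) → B_n(S)` induced by a ring homomorphism `R → S`. -/
def BorelSubgroup.map {n : ℕ} {R S : Type*} [CommRing R] [CommRing S] (f : R →+* S) :
    BorelSubgroup n R →* BorelSubgroup n S where
  toFun A := ⟨Matrix.GeneralLinearGroup.map f A.1, by
    have hA := A.2
    intro i j hij
    show ((Matrix.GeneralLinearGroup.map f A.1 : GL (Fin n) S) : Matrix (Fin n) (Fin n) S) i j = 0
    show ((A.1 : Matrix (Fin n) (Fin n) R).map f) i j = 0
    rw [Matrix.map_apply, hA hij, map_zero]⟩
  map_one' := Subtype.ext (_root_.map_one _)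
  map_mul' A B := Subtype.ext (_root_.map_mul _ _ _)

section SquareZero

variable {R S : Type*} [Ring R] [Ring S]

/-- A surjective ring homomorphism whose kernel has square zero reflects units. -/
theorem RingHom.isUnit_of_map_of_ker_mul_eq_zero {f : R →+* S} (hf : Function.Surjective f)
    (hsq : ∀ a b, f a = 0 → f b = 0 → a * b = 0) {x : R} (hx : IsUnit (f x)) : IsUnit x := by
  have key : ∀ z, f z = 1 → IsUnit z := fun z hz => by
    have h0 : (1 - z) * (1 - z) = 0 := hsq _ _ (by simp [hz]) (by simp [hz])
    have h1 : z * (2 - z) = 1 := by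
      rw [← sub_eq_zero, ← neg_eq_zero, ← h0]; noncomm_ring
    have h2 : (2 - z) * z = 1 := by
      rw [← sub_eq_zero, ← neg_eq_zero, ← h0]; noncomm_ring
    exact ⟨⟨z, 2 - z, h1, h2⟩, rfl⟩
  obtain ⟨u, hu⟩ := hx
  obtain ⟨y, hy⟩ := hf (↑u⁻¹ : S)
  obtain ⟨v, hv⟩ := key (x * y) (by rw [map_mul, ← hu, hy, Units.mul_inv])
  obtain ⟨w, hw⟩ := key (y * x) (by rw [map_mul, ← hu, hy, Units.inv_mul])
  refine isUnit_iff_exists_and_exists.2 ⟨⟨y * ↑v⁻¹, ?_⟩, ⟨↑w⁻¹ * y, ?_⟩⟩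
  · rw [← mul_assoc, ← hv, Units.mul_inv]
  · rw [mul_assoc, ← hw, Units.inv_mul]

theorem RingHom.unitsMap_surjective_of_ker_mul_eq_zero {f : R →+* S}
    (hf : Function.Surjective f) (hsq : ∀ a b, f a = 0 → f b = 0 → a * b = 0) :
    Function.Surjective (Units.map (f : R →* S)) := fun u => by
  obtain ⟨x, hx⟩ := hf u
  obtain ⟨v, rfl⟩ := RingHom.isUnit_of_map_of_ker_mul_eq_zero hf hsq (x := x) (hx ▸ u.isUnit)
  exact ⟨v, Units.ext hx⟩

/-- Averaging over a finite index set is multiplicative on families with constant image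
under a ring homomorphism whose kernel has square zero. -/
theorem RingHom.card_mul_sum_mul_of_ker_mul_eq_zero {f : R →+* S}
    (hsq : ∀ a b, f a = 0 → f b = 0 → a * b = 0) {ι : Type*} [Fintype ι] (u v : ι → R)
    (c d : R) (hu : ∑ i, u i = Fintype.card ι * c) (hv : ∑ i, v i = Fintype.card ι * d)
    (hfu : ∀ i, f (u i) = f c) (hfv : ∀ i, f (v i) = f d) :
    ∑ i, u i * v i = Fintype.card ι * (c * d) := by
  have h : ∀ i, u i * v i = u i * d + c * v i - c * d := fun i => by
    have := hsq (u i - c) (v i - d) (by simp [hfu]) (by simp [hfv])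
    rw [← sub_eq_zero, ← this]; noncomm_ring
  simp only [h, Finset.sum_sub_distrib, Finset.sum_add_distrib, ← Finset.sum_mul,
    ← Finset.mul_sum, hu, hv, Finset.sum_const, Finset.card_univ, nsmul_eq_mul]
  rw [← mul_assoc c, (Nat.cast_commute _ c).symm.eq]
  noncomm_ring

/-- Let `f : R → S` be a surjective ring homomorphism with square-zero kernel. A homomorphism
`ρ : G → Sˣ` lifts to `Rˣ` as soon as its restriction to a subgroup `H` of finite index,
invertible in `S`, does. The lift obtained is trivial on every element all of whose conjugates
are in the kernel of the lift on `H`. -/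
theorem exists_units_lift_of_finiteIndex {f : R →+* S} (hf : Function.Surjective f)
    (hsq : ∀ a b, f a = 0 → f b = 0 → a * b = 0) {G : Type*} [Group G] (H : Subgroup G)
    [H.FiniteIndex] (hm : IsUnit (H.index : S)) (ρ : G →* Sˣ) (σ : H →* Rˣ)
    (hσ : ∀ h : H, Units.map (f : R →* S) (σ h) = ρ h) :
    ∃ ρ' : G →* Rˣ, (Units.map (f : R →* S)).comp ρ' = ρ ∧
      ∀ g, (∀ t, ∃ h : H, (h : G) = t⁻¹ * g * t ∧ σ h = 1) → ρ' g = 1 := by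
  classical
  let _ := H.fintypeQuotientOfFiniteIndex
  have hcard : H.index = Fintype.card (G ⧸ H) := by
    rw [Subgroup.index, Nat.card_eq_fintype_card]
  rw [hcard] at hm
  set m := Fintype.card (G ⧸ H)
  obtain ⟨M, hM⟩ : IsUnit (m : R) :=
    RingHom.isUnit_of_map_of_ker_mul_eq_zero hf hsq (by simpa using hm)
  choose e he using fun q : G ⧸ H =>
    RingHom.unitsMap_surjective_of_ker_mul_eq_zero hf hsq (ρ q.out)
  have hmem : ∀ g : G, (g : G ⧸ H).out⁻¹ * g ∈ H := fun g =>
    QuotientGroup.eq.1 (Quotient.out_eq' (g : G ⧸ H))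
  let s : G → Rˣ := fun g => e g * σ ⟨_, hmem g⟩
  have hs : ∀ g, Units.map (f : R →* S) (s g) = ρ g := fun g => by
    simp [s, he, hσ]
  have hsH : ∀ (g : G) (h : H), s (g * h) = s g * σ h := fun g h => by
    have hq : ((g * h : G) : G ⧸ H) = g := QuotientGroup.mk_mul_of_mem g h.2
    have hσq : (⟨_, hmem (g * h)⟩ : H) = ⟨_, hmem g⟩ * h :=
      Subtype.ext (by simp [hq, mul_assoc])
    simp only [s]
    rw [hσq, map_mul, congrArg e hq, mul_assoc]
  let u : G → G ⧸ H → Rˣ := fun g q => s (g * q.out) * (s q.out)⁻¹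
  have hu_mk : ∀ g t : G, u g t = s (g * t) * (s t)⁻¹ := fun g t => by
    have ht : t = (t : G ⧸ H).out * (⟨_, hmem t⟩ : H) := by simp
    conv_rhs => rw [ht, ← mul_assoc, hsH, hsH]
    simp [u]
  have hu_mul : ∀ (g g' : G) (q : G ⧸ H), u (g * g') q = u g (g' • q) * u g' q :=
    fun g g' q => by
      obtain ⟨t, rfl⟩ := QuotientGroup.mk_surjective q
      rw [MulAction.Quotient.smul_coe, hu_mk, hu_mk, hu_mk, smul_eq_mul, mul_assoc g]
      group
  have hfu : ∀ g q, f (u g q) = ρ g := fun g q => by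
    have : Units.map (f : R →* S) (u g q) = ρ g := by simp [u, hs]
    simpa using congrArg Units.val this
  let r : G → R := fun g => ↑M⁻¹ * ∑ q, (u g q : R)
  have hr : ∀ g, ∑ q, (u g q : R) = m * r g := fun g => by
    simp [r, ← hM]
  have hfr : ∀ g, f (r g) = ρ g := fun g => by
    have h := congrArg f (hr g)
    simp only [map_sum, hfu, Finset.sum_const, Finset.card_univ, nsmul_eq_mul, map_mul,
      map_natCast] at h
    exact (hm.mul_left_cancel h).symm
  have hr_eq_one : ∀ g, (∀ q, u g q = 1) → r g = 1 := fun g h => by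
    have h1 : ∑ q, (u g q : R) = M := by simp [h, hM, m]
    simp only [r, h1, Units.inv_mul]
  have hr_mul : ∀ g g', r (g * g') = r g * r g' := fun g g' => by
    have h := RingHom.card_mul_sum_mul_of_ker_mul_eq_zero hsq
      (fun q => (u g (g' • q) : R)) (fun q => (u g' q : R)) (r g) (r g')
      (by rw [← hr]; exact Equiv.sum_comp (MulAction.toPerm g') fun q => (u g q : R))
      (hr g') (fun q => by rw [hfu, hfr]) (fun q => by rw [hfu, hfr])
    simp only [← Units.val_mul, ← hu_mul, hr] at h
    exact (hM ▸ M.isUnit : IsUnit (m : R)).mul_left_cancel h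
  let ρ' : G →* R :=
    { toFun := r
      map_one' := hr_eq_one 1 fun q => by simp [u]
      map_mul' := hr_mul }
  refine ⟨ρ'.toHomUnits, MonoidHom.ext fun g => Units.ext (hfr g), fun g hg =>
    Units.ext (hr_eq_one g fun q => ?_)⟩
  obtain ⟨t, rfl⟩ := QuotientGroup.mk_surjective q
  obtain ⟨h, hh, hh1⟩ := hg t
  have : g * t = t * h := by rw [hh]; group
  rw [hu_mk, this, hsH, hh1, mul_one, mul_inv_cancel]

end SquareZero

section Witt

variable (p : ℕ) [Fact p.Prime] (k : Type*) [CommRing k]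

theorem wittReduce_surjective : Function.Surjective (wittReduce p k) := fun x =>
  ⟨TruncatedWittVector.mk p fun _ => x,
    TruncatedWittVector.coeff_mk (p := p) (fun _ => x) (0 : Fin 2)⟩

theorem mul_eq_zero_of_wittReduce_eq_zero [CharP k p] (x y : TruncatedWittVector p 2 k)
    (hx : wittReduce p k x = 0) (hy : wittReduce p k y = 0) : x * y = 0 := by
  obtain ⟨X, rfl⟩ := WittVector.truncate_surjective (p := p) 2 k x
  obtain ⟨Y, rfl⟩ := WittVector.truncate_surjective (p := p) 2 k y
  have key : ∀ Z : WittVector p k, wittReduce p k (WittVector.truncate 2 Z) = 0 →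
      ∃ Z', Z = WittVector.verschiebung Z' := fun Z hZ => by
    have h0 : Z.coeff 0 = 0 := by
      rw [← hZ]; exact (WittVector.coeff_truncate Z (0 : Fin 2)).symm
    exact ⟨Z.shift 1, WittVector.eq_iterate_verschiebung (n := 1) (by simpa using h0)⟩
  obtain ⟨X', rfl⟩ := key X hx
  obtain ⟨Y', rfl⟩ := key Y hy
  rw [← map_mul, ← WittVector.verschiebung_mul_frobenius, WittVector.frobenius_verschiebung]
  rw [← RingHom.mem_ker, WittVector.mem_ker_truncate]
  intro i hi
  interval_cases i
  · simp
  · rw [WittVector.verschiebung_coeff_succ, WittVector.mul_coeff_zero, WittVector.mul_coeff_zero]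
    have : (p : WittVector p k).coeff 0 = 0 := by
      rw [← WittVector.constantCoeff_apply, map_natCast, CharP.cast_eq_zero]
    rw [this, mul_zero, mul_zero]

end Witt

theorem RingHom.mapMatrix_mul_eq_zero {R S ι : Type*} [Ring R] [Ring S] [Fintype ι]
    [DecidableEq ι] {f : R →+* S} (hsq : ∀ a b, f a = 0 → f b = 0 → a * b = 0)
    (A B : Matrix ι ι R) (hA : f.mapMatrix A = 0) (hB : f.mapMatrix B = 0) : A * B = 0 := by
  ext i j
  rw [Matrix.mul_apply]
  exact Finset.sum_eq_zero fun l _ => hsq _ _ (congrFun₂ hA i l) (congrFun₂ hB l j)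

theorem RingHom.mapMatrix_surjective {R S ι : Type*} [Ring R] [Ring S] [Fintype ι]
    [DecidableEq ι] {f : R →+* S} (hf : Function.Surjective f) :
    Function.Surjective (f.mapMatrix : Matrix ι ι R →+* Matrix ι ι S) := fun B =>
  ⟨B.map (Function.surjInv hf), by ext; simp [Function.surjInv_eq]⟩

section PGroup

open MulAction

/-- A finite `p`-group acting linearly on a nonzero vector space of characteristic `p` has a
nonzero fixed vector. -/
theorem IsPGroup.exists_ne_zero_forall_apply_eq {p : ℕ} [Fact p.Prime] {P : Type*} [Group P]
    [Finite P] (hP : IsPGroup p P) {k V : Type*} [Field k] [CharP k p] [AddCommGroup V]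
    [Module k V] [Nontrivial V] (ρ : Representation k P V) :
    ∃ v ≠ 0, ∀ g, ρ g v = v := by
  obtain ⟨w, hw⟩ := exists_ne (0 : V)
  let _ : Algebra (ZMod p) k := ZMod.algebra k p
  let _ : Module (ZMod p) V := Module.compHom V (algebraMap (ZMod p) k)
  let W : Submodule (ZMod p) V := Submodule.span _ (Set.range fun g => ρ g w)
  have : Module.Finite (ZMod p) W := Module.Finite.span_of_finite _ (Set.finite_range _)
  have : Finite W := Module.finite_of_finite (ZMod p)
  have hinv : ∀ g, ∀ x ∈ W, ρ g x ∈ W := fun g x hx => by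
    induction hx using Submodule.span_induction with
    | mem x hx =>
      obtain ⟨h, rfl⟩ := hx
      exact Submodule.subset_span ⟨g * h, by simp⟩
    | zero => simp
    | add x y _ _ hx hy => rw [map_add]; exact W.add_mem hx hy
    | smul a x _ hx =>
      have : ρ g (a • x) = a • ρ g x := (ρ g).map_smul (algebraMap (ZMod p) k a) x
      rw [this]; exact W.smul_mem a hx
  let _ : MulAction P W :=
    { smul := fun g x => ⟨ρ g x, hinv g x x.2⟩
      one_smul := fun x => Subtype.ext (by change ρ 1 x = x; simp)
      mul_smul := fun g h x => Subtype.ext (by change ρ (g * h) x = ρ g (ρ h x); simp) }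
  have hsmul : ∀ (g : P) (x : W), ((g • x : W) : V) = ρ g x := fun _ _ => rfl
  have hwW : w ∈ W := Submodule.subset_span ⟨1, by simp⟩
  have : Nontrivial W := ⟨⟨w, hwW⟩, 0, fun h => hw (congrArg Subtype.val h)⟩
  have hcard : p ∣ Nat.card W := by
    rw [Module.natCard_eq_pow_finrank (K := ZMod p), Nat.card_zmod]
    exact dvd_pow_self p Module.finrank_pos.ne'
  obtain ⟨b, hb, hb0⟩ := hP.exists_fixed_point_of_prime_dvd_card_of_fixed_point W hcard
    (a := 0) fun g => Subtype.ext (by rw [hsmul]; simp)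
  exact ⟨b, fun h => hb0 (Subtype.ext h.symm), fun g => congrArg Subtype.val (hb g)⟩

/-- A finite `p`-group acting linearly on a vector space of characteristic `p` stabilizes the
flag of a linearly independent family of any length up to the dimension. -/
theorem IsPGroup.exists_linearIndependent_apply_sub_mem_span {p : ℕ} [Fact p.Prime]
    {P : Type*} [Group P] [Finite P] (hP : IsPGroup p P) {k V : Type*} [Field k] [CharP k p]
    [AddCommGroup V] [Module k V] (ρ : Representation k P V) (m : ℕ)
    (hm : m ≤ Module.finrank k V) :
    ∃ v : Fin m → V, LinearIndependent k v ∧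
      ∀ g j, ρ g (v j) - v j ∈ Submodule.span k (v '' Set.Iio j) := by
  induction m with
  | zero => exact ⟨Fin.elim0, linearIndependent_empty_type, fun _ j => j.elim0⟩
  | succ m ih =>
    obtain ⟨v, hv, hvρ⟩ := ih (Nat.le_of_succ_le hm)
    set W := Submodule.span k (Set.range v)
    have hW : ∀ g, W ≤ W.comap (ρ g) := fun g => Submodule.span_le.2 <| by
      rintro _ ⟨j, rfl⟩
      have h1 := Submodule.span_mono (Set.image_subset_range _ _) (hvρ g j)
      simpa using W.add_mem h1 (Submodule.subset_span ⟨j, rfl⟩)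
    have hWtop : W ≠ ⊤ := fun h => by
      have := finrank_range_le_card (R := k) v
      rw [Set.finrank, show Submodule.span k (Set.range v) = ⊤ from h, finrank_top,
        Fintype.card_fin] at this
      omega
    have : Nontrivial (V ⧸ W) := Submodule.Quotient.nontrivial_iff.2 hWtop
    obtain ⟨q, hq0, hq⟩ := hP.exists_ne_zero_forall_apply_eq (ρ.quotient W hW)
    obtain ⟨x, rfl⟩ := W.mkQ_surjective q
    refine ⟨Fin.snoc v x, hv.finSnoc fun hx => hq0 (by simpa using hx), fun g j => ?_⟩
    refine Fin.lastCases ?_ (fun j => ?_) j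
    · have h1 : ρ g x - x ∈ W := (Submodule.Quotient.eq W).1 (hq g)
      rw [Fin.snoc_last]
      refine Submodule.span_mono ?_ h1
      rintro _ ⟨i, rfl⟩
      exact ⟨i.castSucc, Fin.castSucc_lt_last i, by simp⟩
    · rw [Fin.snoc_castSucc]
      refine Submodule.span_mono ?_ (hvρ g j)
      rintro _ ⟨i, hi, rfl⟩
      exact ⟨i.castSucc, Fin.castSucc_lt_castSucc_iff.2 hi, by simp⟩

/-- A finite `p`-subgroup of `GL_n` of a field of characteristic `p` is conjugate to a group of
upper triangular matrices. -/
theorem IsPGroup.exists_conj_mem_borelSubgroup {p : ℕ} [Fact p.Prime] {k : Type*} [Field k]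
    [CharP k p] {n : ℕ} (P : Subgroup (GL (Fin n) k)) [Finite P] (hP : IsPGroup p P) :
    ∃ c : GL (Fin n) k, ∀ g ∈ P, c⁻¹ * g * c ∈ BorelSubgroup n k := by
  let ρ : Representation k P (Fin n → k) :=
    (Matrix.toLinAlgEquiv' : Matrix (Fin n) (Fin n) k ≃ₐ[k] _).toMonoidHom.comp
      ((Units.coeHom _).comp P.subtype)
  obtain ⟨v, hv, hvρ⟩ := hP.exists_linearIndependent_apply_sub_mem_span ρ n (by simp)
  let C : Matrix (Fin n) (Fin n) k := (Matrix.of v)ᵀ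
  obtain ⟨c, hc⟩ : IsUnit C := Matrix.linearIndependent_cols_iff_isUnit.1 hv
  refine ⟨c, fun g hg i j hij => ?_⟩
  have hcol : ∀ j, v j = C *ᵥ Pi.single j 1 := fun j => by
    rw [Matrix.mulVec_single_one]; rfl
  have hmem : g.1 *ᵥ v j ∈ Submodule.span k (v '' Set.Iic j) := by
    have h1 := Submodule.span_mono (Set.image_mono Set.Iio_subset_Iic_self) (hvρ ⟨g, hg⟩ j)
    simpa [ρ] using add_mem h1 (Submodule.subset_span ⟨j, Set.self_mem_Iic, rfl⟩)
  have hle : Submodule.span k (v '' Set.Iic j) ≤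
      LinearMap.ker ((LinearMap.proj i : (Fin n → k) →ₗ[k] k) ∘ₗ (c⁻¹).1.mulVecLin) := by
    refine Submodule.span_le.2 ?_
    rintro _ ⟨l, hl, rfl⟩
    have hil : i ≠ l := (lt_of_le_of_lt hl hij).ne'
    simp only [SetLike.mem_coe, LinearMap.mem_ker, LinearMap.comp_apply, Matrix.mulVecLin_apply,
      LinearMap.proj_apply]
    rw [hcol, ← hc, Matrix.mulVec_mulVec, Units.inv_mul, Matrix.one_mulVec,
      Pi.single_eq_of_ne hil]
  have h := hle hmem
  simp only [LinearMap.mem_ker, LinearMap.comp_apply, Matrix.mulVecLin_apply,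
      LinearMap.proj_apply] at h
  rw [hcol, ← hc, Matrix.mulVec_mulVec, Matrix.mulVec_mulVec, Matrix.mulVec_single_one] at h
  simpa [Matrix.mul_assoc] using h

end PGroup

section Galois

variable {K L : Type*} [Field K] [Field L] [Algebra K L]

/-- A homomorphism from a Galois group to a discrete group that is trivial on the fixing subgroup
of a finite extension is continuous. -/
theorem continuous_bot_of_fixingSubgroup_le_ker {M : Type*} [Group M] (φ : Gal(L/K) →* M)
    (E : IntermediateField K L) [FiniteDimensional K E] (hE : E.fixingSubgroup ≤ φ.ker) :
    Continuous[_, ⊥] φ := by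
  let _ : TopologicalSpace M := ⊥
  have : DiscreteTopology M := ⟨rfl⟩
  refine continuous_of_continuousAt_one φ ?_
  rw [ContinuousAt, map_one, nhds_discrete M, Filter.tendsto_pure, Filter.Eventually,
    krullTopology_mem_nhds_one_iff]
  exact ⟨E, inferInstance, hE⟩

/-- A homomorphism from a Galois group to a discrete group is continuous if and only if it is
trivial on the pointwise stabilizer of some finite set. -/
theorem continuous_bot_iff_exists_finite [Algebra.IsAlgebraic K L] {M : Type*} [Group M]
    (φ : Gal(L/K) →* M) :
    Continuous[_, ⊥] φ ↔ ∃ S : Set L, S.Finite ∧ ∀ σ, (∀ x ∈ S, σ x = x) → φ σ = 1 := by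
  constructor
  · intro h
    let _ : TopologicalSpace M := ⊥
    have : DiscreteTopology M := ⟨rfl⟩
    have hφ : Continuous φ := h
    have hker : (φ ⁻¹' {1}) ∈ 𝓝 (1 : Gal(L/K)) :=
      ((isOpen_discrete ({1} : Set M)).preimage hφ).mem_nhds (by simp)
    obtain ⟨E, hE, hEφ⟩ := (krullTopology_mem_nhds_one_iff K L _).1 hker
    obtain ⟨s, rfl⟩ := IntermediateField.essFiniteType_iff.1
      (inferInstance : Algebra.EssFiniteType K E)
    refine ⟨s, s.finite_toSet, fun σ hσ => hEφ ?_⟩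
    exact (IntermediateField.mem_fixingSubgroup_iff _ _).2
      ((IntermediateField.forall_mem_adjoin_smul_eq_self_iff K σ).2 hσ)
  · rintro ⟨S, hS, hφ⟩
    have := hS.to_subtype
    have := IntermediateField.finiteDimensional_adjoin (K := K) (S := S)
      fun x _ => Algebra.IsIntegral.isIntegral x
    exact continuous_bot_of_fixingSubgroup_le_ker φ (IntermediateField.adjoin K S)
      fun σ hσ => hφ σ fun x hx => (IntermediateField.mem_fixingSubgroup_iff _ _).1 hσ x
        (IntermediateField.subset_adjoin K S hx)

theorem exists_normal_fixingSubgroup_le [Normal K L] {S : Set L} (hS : S.Finite) :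
    ∃ E : IntermediateField K L, FiniteDimensional K E ∧ Normal K E ∧
      ∀ σ ∈ E.fixingSubgroup, ∀ x ∈ S, σ x = x := by
  have := hS.to_subtype
  have := IntermediateField.finiteDimensional_adjoin (K := K) (S := S)
    fun x _ => Normal.isIntegral inferInstance x
  refine ⟨IntermediateField.normalClosure K (IntermediateField.adjoin K S) L, inferInstance,
    inferInstance, fun σ hσ x hx => (IntermediateField.mem_fixingSubgroup_iff _ _).1 hσ x ?_⟩
  exact IntermediateField.le_normalClosure _ (IntermediateField.subset_adjoin K S hx)

theorem finiteIndex_fixingSubgroup_of_normal [Normal K L] (E : IntermediateField K L)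
    [FiniteDimensional K E] [Normal K E] : E.fixingSubgroup.FiniteIndex := by
  rw [← E.restrictNormalHom_ker]
  infer_instance

theorem normal_fixingSubgroup_of_normal [Normal K L] (E : IntermediateField K L)
    [Normal K E] : E.fixingSubgroup.Normal := by
  rw [← E.restrictNormalHom_ker]
  infer_instance

/-- An open subgroup of the automorphism group of a normal extension, not necessarily
separable, is the fixing subgroup of its fixed field. -/
theorem fixingSubgroup_fixedField_of_fixingSubgroup_le (H : Subgroup Gal(L/K))
    (E : IntermediateField K L) [FiniteDimensional K E] [Normal K E]
    (hE : E.fixingSubgroup ≤ H) :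
    (IntermediateField.fixedField H).fixingSubgroup = H := by
  refine le_antisymm (fun σ hσ => ?_) ((IntermediateField.le_iff_le _ _).1 le_rfl)
  have hmem : AlgEquiv.restrictNormalHom E σ ∈ H.map (AlgEquiv.restrictNormalHom E) := by
    rw [← IntermediateField.fixingSubgroup_fixedField (H.map (AlgEquiv.restrictNormalHom E)),
      IntermediateField.mem_fixingSubgroup_iff]
    intro x hx
    rw [IntermediateField.mem_fixedField_iff] at hx
    refine Subtype.ext ?_
    rw [AlgEquiv.restrictNormalHom_apply]
    refine (IntermediateField.mem_fixingSubgroup_iff _ _).1 hσ _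
      ((IntermediateField.mem_fixedField_iff _ _).2 fun h hh => ?_)
    rw [← AlgEquiv.restrictNormalHom_apply E, hx _ ⟨h, hh, rfl⟩]
  obtain ⟨h, hh, hhσ⟩ := hmem
  have h1 : h⁻¹ * σ ∈ E.fixingSubgroup := by
    rw [← E.restrictNormalHom_ker, MonoidHom.mem_ker, map_mul, map_inv, hhσ, inv_mul_cancel]
  simpa using H.mul_mem hh (hE h1)

end Galois

/-- Any algebraic closure of `K` is isomorphic to `AlgebraicClosure K`. -/
noncomputable def AlgebraicClosure.equivOfIsAlgClosure (K L : Type*) [Field K] [Field L]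
    [Algebra K L] [IsAlgClosure K L] : AlgebraicClosure K ≃ₐ[K] L :=
  IsAlgClosure.equiv K _ _

/-- If continuous homomorphisms to `B` from the absolute Galois group of an intermediate field
`K'` of the algebraic closure of `K` lift along `α : B' → B`, then so do homomorphisms from the
fixing subgroup of `K'` that are trivial on the stabilizer of a finite set. -/
theorem exists_lift_fixingSubgroup {K : Type*} [Field K]
    (K' : IntermediateField K (AlgebraicClosure K)) {B B' : Type*} [Group B] [Group B']
    (α : B' →* B)
    (hα : ∀ φ : Gal(AlgebraicClosure K'/K') →* B, Continuous[_, ⊥] φ →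
      ∃ φ' : Gal(AlgebraicClosure K'/K') →* B', Continuous[_, ⊥] φ' ∧ α.comp φ' = φ)
    (τ : K'.fixingSubgroup →* B)
    (hτ : ∃ S : Set (AlgebraicClosure K), S.Finite ∧
      ∀ h : K'.fixingSubgroup, (∀ x ∈ S, (h : Gal(AlgebraicClosure K/K)) x = x) → τ h = 1) :
    ∃ τ' : K'.fixingSubgroup →* B', α.comp τ' = τ ∧
      ∃ S : Set (AlgebraicClosure K), S.Finite ∧
        ∀ h : K'.fixingSubgroup, (∀ x ∈ S, (h : Gal(AlgebraicClosure K/K)) x = x) →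
          τ' h = 1 := by
  have : Algebra.IsAlgebraic K' (AlgebraicClosure K) := Algebra.IsAlgebraic.tower_top (K := K) K'
  have : IsAlgClosure K' (AlgebraicClosure K) := ⟨inferInstance, inferInstance⟩
  let e : AlgebraicClosure K' ≃ₐ[K'] AlgebraicClosure K := AlgebraicClosure.equivOfIsAlgClosure K' _
  let θ : Gal(AlgebraicClosure K'/K') ≃* K'.fixingSubgroup :=
    (AlgEquiv.autCongr e).trans K'.fixingSubgroupEquiv.symm
  have hθ : ∀ σ x, (θ σ : Gal(AlgebraicClosure K/K)) x = e (σ (e.symm x)) := fun _ _ => rfl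
  obtain ⟨S, hS, hSτ⟩ := hτ
  obtain ⟨φ', hφ', hφτ⟩ := hα (τ.comp (θ : _ →* _)) <|
    (continuous_bot_iff_exists_finite (K := K') (τ.comp (θ : _ →* _))).2
      ⟨e.symm '' S, hS.image _, fun σ hσ => hSτ _ fun x hx => by
        rw [MonoidHom.coe_coe, hθ, hσ _ ⟨x, hx, rfl⟩, e.apply_symm_apply]⟩
  obtain ⟨T, hT, hTφ⟩ := (continuous_bot_iff_exists_finite (K := K')
    (L := AlgebraicClosure K') φ').1 hφ'
  refine ⟨φ'.comp (θ.symm : _ →* _), ?_, e '' T, hT.image _, fun h hh => hTφ _ fun x hx => ?_⟩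
  · rw [← MonoidHom.comp_assoc, hφτ]
    ext h
    simp
  · apply e.injective
    have := hh _ ⟨x, hx, rfl⟩
    rw [← θ.apply_symm_apply h, hθ, e.symm_apply_apply] at this
    exact this

/-- If, for every field extension `K/F`, every continuous homomorphism
`Γ_K → B_n(k)` lifts to `B_n(W₂(k))`, then for every field extension `K/F` every continuous
homomorphism `Γ_K → GL_n(k)` lifts to `GL_n(W₂(k))`. -/
theorem borel_lifting_implies_gl_lifting
    (p : ℕ) [Fact p.Prime] (F : Type) [Field F] (k : Type) [Field k] [CharP k p]
    (n : ℕ) (hn : 0 < n)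
    (hB : ∀ (K : Type) [Field K] [Algebra F K]
      (ρ : Field.absoluteGaloisGroup K →* BorelSubgroup n k), Continuous[_, ⊥] ⇑ρ →
      ∃ ρ' : Field.absoluteGaloisGroup K →* BorelSubgroup n (TruncatedWittVector p 2 k),
        Continuous[_, ⊥] ⇑ρ' ∧ (BorelSubgroup.map (wittReduce p k)).comp ρ' = ρ) :
    ∀ (K : Type) [Field K] [Algebra F K]
      (ρ : Field.absoluteGaloisGroup K →* GL (Fin n) k), Continuous[_, ⊥] ⇑ρ →
      ∃ ρ' : Field.absoluteGaloisGroup K →* GL (Fin n) (TruncatedWittVector p 2 k),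
        Continuous[_, ⊥] ⇑ρ' ∧
          (Matrix.GeneralLinearGroup.map (wittReduce p k)).comp ρ' = ρ := by
  intro K _ _ (ρ : Gal(AlgebraicClosure K/K) →* GL (Fin n) k) hρ
  let f : Matrix (Fin n) (Fin n) _ →+* Matrix (Fin n) (Fin n) k := (wittReduce p k).mapMatrix
  have hf := RingHom.mapMatrix_surjective (ι := Fin n) (wittReduce_surjective p k)
  have hsq := RingHom.mapMatrix_mul_eq_zero (ι := Fin n) (mul_eq_zero_of_wittReduce_eq_zero p k)
  obtain ⟨S, hS, hSρ⟩ := (continuous_bot_iff_exists_finite (L := AlgebraicClosure K) ρ).1 hρ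
  obtain ⟨E, _, _, hE⟩ := exists_normal_fixingSubgroup_le (K := K) hS
  have hEρ : E.fixingSubgroup ≤ ρ.ker := fun σ hσ => hSρ σ (hE σ hσ)
  have := finiteIndex_fixingSubgroup_of_normal E
  have : (ρ.ker).FiniteIndex := Subgroup.finiteIndex_of_le hEρ
  have : Finite ρ.range := Finite.of_equiv _ (QuotientGroup.quotientKerEquivRange ρ).toEquiv
  obtain ⟨P⟩ : Nonempty (Sylow p ρ.range) := inferInstance
  let H : Subgroup Gal(AlgebraicClosure K/K) := P.toSubgroup.comap ρ.rangeRestrict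
  have hHρ : ρ.ker ≤ H := by
    rw [← MonoidHom.ker_rangeRestrict]
    exact Subgroup.ker_le_comap _ _
  have hHindex : H.index = P.index :=
    Subgroup.index_comap_of_surjective _ ρ.rangeRestrict_surjective
  have hHfix := fixingSubgroup_fixedField_of_fixingSubgroup_le H E (hEρ.trans hHρ)
  set K' := IntermediateField.fixedField H
  have : Finite (P.toSubgroup.map ρ.range.subtype) :=
    Finite.of_surjective _ (ρ.range.subtype.subgroupMap_surjective P.toSubgroup)
  obtain ⟨c, hc⟩ := IsPGroup.exists_conj_mem_borelSubgroup
    (P.toSubgroup.map ρ.range.subtype) (P.isPGroup'.map _)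
  have hρc : ∀ h : K'.fixingSubgroup, c⁻¹ * ρ h * c ∈ BorelSubgroup n k := fun h =>
    hc _ ⟨ρ.rangeRestrict h, hHfix.le h.2, rfl⟩
  let τ : K'.fixingSubgroup →* BorelSubgroup n k :=
    ((MulAut.conj c⁻¹).toMonoidHom.comp (MonoidHom.comp ρ K'.fixingSubgroup.subtype)).codRestrict _
      fun h => by simpa using hρc h
  have hτ : ∀ h, (τ h : GL (Fin n) k) = c⁻¹ * ρ h * c := fun h => by simp [τ]
  obtain ⟨τ', hτ', T, hT, hTτ⟩ := exists_lift_fixingSubgroup K' _ (hB K') τ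
    ⟨S, hS, fun h hh => Subtype.ext (by rw [hτ, hSρ h hh]; simp)⟩
  obtain ⟨C, hC⟩ := RingHom.unitsMap_surjective_of_ker_mul_eq_zero hf hsq c
  let σ : K'.fixingSubgroup →* GL (Fin n) (TruncatedWittVector p 2 k) :=
    (MulAut.conj C).toMonoidHom.comp ((BorelSubgroup n _).subtype.comp τ')
  have hindex : IsUnit ((K'.fixingSubgroup.index : ℕ) : Matrix (Fin n) (Fin n) k) := by
    have h : IsUnit (K'.fixingSubgroup.index : k) := by
      rw [isUnit_iff_ne_zero, Ne, CharP.cast_eq_zero_iff k p, hHfix, hHindex]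
      exact P.not_dvd_index
    simpa using h.map (algebraMap k (Matrix (Fin n) (Fin n) k))
  have : K'.fixingSubgroup.FiniteIndex := by
    rw [hHfix]; exact Subgroup.finiteIndex_of_le hHρ
  obtain ⟨ρ', hρ', hρ'_one⟩ := exists_units_lift_of_finiteIndex hf hsq
    K'.fixingSubgroup hindex ρ σ fun h => by
      have h1 : Units.map (f : _ →* Matrix (Fin n) (Fin n) k)
          (τ' h : GL (Fin n) (TruncatedWittVector p 2 k)) = c⁻¹ * ρ h * c := by
        rw [← hτ, ← hτ']; rfl
      have h2 : σ h = C * τ' h * C⁻¹ := rfl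
      rw [h2, map_mul, map_mul, map_inv, hC, h1]
      group
  refine ⟨ρ', ?_, hρ'⟩
  obtain ⟨E', _, _, hE'⟩ := exists_normal_fixingSubgroup_le (K := K) (hT.union hS)
  have := normal_fixingSubgroup_of_normal E'
  refine continuous_bot_of_fixingSubgroup_le_ker ρ' E' fun g hg => hρ'_one g fun t => ?_
  have hfix := hE' _ (by simpa using this.conj_mem g hg t⁻¹ : t⁻¹ * g * t ∈ E'.fixingSubgroup)
  refine ⟨⟨t⁻¹ * g * t, hHfix.ge (hHρ (hSρ _ fun x hx => hfix x (Or.inr hx)))⟩, rfl, ?_⟩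
  simp only [σ, MonoidHom.comp_apply]
  rw [hTτ _ fun x hx => hfix x (Or.inl hx), map_one, map_one]
end

section
/- Let F be a field, let k be a field of characteristic p > 0, and let n ≥ m be positive integers. If for every field extension K/F every continuous homomorphism Γ_K → GL_n(k) lifts to a continuous homomorphism Γ_K → GL_n(W₂(k)) along π, then for every field extension K/F every continuous homomorphism Γ_K → GL_m(k) lifts to a continuous homomorphism Γ_K → GL_m(W₂(k)) along π. Similarly, if for every field extension K/F every continuous homomorphism Γ_K → B_n(k) lifts to B_n(W₂(k)) along π, then for every field extension K/F every continuous homomorphism Γ_K → B_m(k) lifts to B_m(W₂(k)) along π. -/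
open Matrix Topology

/-- The block-diagonal embedding `GL_m(R) → GL_{m+d}(R)`, `A ↦ A ⊕ 1`. -/
def blockExtend (m d : ℕ) (R : Type*) [CommRing R] : GL (Fin m) R →* GL (Fin (m + d)) R :=
  Units.map
    { toFun := fun A => (fromBlocks A 0 0 (1 : Matrix (Fin d) (Fin d) R)).submatrix
        finSumFinEquiv.symm finSumFinEquiv.symm
      map_one' := by rw [fromBlocks_one, submatrix_one_equiv]
      map_mul' := fun A B => by
        rw [submatrix_mul_equiv, fromBlocks_multiply]
        simp }

lemma blockExtend_val {m d : ℕ} {R : Type*} [CommRing R] (A : GL (Fin m) R) :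
    (blockExtend m d R A : Matrix (Fin (m + d)) (Fin (m + d)) R) =
      (fromBlocks (A : Matrix (Fin m) (Fin m) R) 0 0 1).submatrix
        finSumFinEquiv.symm finSumFinEquiv.symm :=
  rfl

lemma blockExtend_mem_borelSubgroup {m d : ℕ} {R : Type*} [CommRing R] {A : GL (Fin m) R}
    (hA : A ∈ BorelSubgroup m R) : blockExtend m d R A ∈ BorelSubgroup (m + d) R := by
  intro i j hij
  rw [blockExtend_val]
  induction i using Fin.addCases with
  | left i =>
    induction j using Fin.addCases with
    | left j => simpa using hA (i := i) (j := j) hij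
    | right j => simp
  | right i =>
    induction j using Fin.addCases with
    | left j => simp
    | right j =>
      have hne : i ≠ j := by
        rintro rfl
        exact lt_irrefl _ hij
      simp [hne]

/-- The leading block of a product is the product of the leading blocks, as soon as the
off-diagonal blocks involved lie in the square-zero kernel of a ring homomorphism. -/
lemma submatrix_castAdd_mul {m d : ℕ} {R S : Type*} [CommRing R] [CommRing S] (f : R →+* S)
    (hf : ∀ a b, f a = 0 → f b = 0 → a * b = 0) {A B : Matrix (Fin (m + d)) (Fin (m + d)) R}
    (hA : ∀ i j, f (A (Fin.castAdd d i) (Fin.natAdd m j)) = 0)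
    (hB : ∀ i j, f (B (Fin.natAdd m i) (Fin.castAdd d j)) = 0) :
    (A * B).submatrix (Fin.castAdd d) (Fin.castAdd d) =
      A.submatrix (Fin.castAdd d) (Fin.castAdd d) *
        B.submatrix (Fin.castAdd d) (Fin.castAdd d) := by
  ext i j
  simp [Matrix.mul_apply, Fin.sum_univ_add, hf _ _ (hA i _) (hB _ j)]

/-- A lift of `ρ ⊕ 1` along a ring homomorphism with square-zero kernel yields a lift of `ρ`,
given by the leading block. -/
lemma exists_lift_of_lift_blockExtend {G : Type*} [Group G] {m d : ℕ} {R S : Type*} [CommRing R]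
    [CommRing S] (f : R →+* S) (hf : ∀ a b, f a = 0 → f b = 0 → a * b = 0)
    (ρ : G →* GL (Fin m) S) (σ : G →* GL (Fin (m + d)) R)
    (hσ : (Matrix.GeneralLinearGroup.map f).comp σ = (blockExtend m d S).comp ρ) :
    ∃ τ : G →* GL (Fin m) R,
      (∀ g, (τ g : Matrix (Fin m) (Fin m) R) =
        (σ g : Matrix (Fin (m + d)) (Fin (m + d)) R).submatrix (Fin.castAdd d) (Fin.castAdd d)) ∧
      (Matrix.GeneralLinearGroup.map f).comp τ = ρ := by
  have key (g : G) (i j : Fin (m + d)) : f ((σ g : Matrix _ _ R) i j) =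
      (fromBlocks (ρ g : Matrix (Fin m) (Fin m) S) 0 0 1).submatrix
        finSumFinEquiv.symm finSumFinEquiv.symm i j :=
    congrArg (fun A : GL (Fin (m + d)) S => (A : Matrix _ _ S) i j) (DFunLike.congr_fun hσ g)
  let τ₀ : G →* Matrix (Fin m) (Fin m) R :=
    { toFun := fun g => (σ g : Matrix (Fin (m + d)) (Fin (m + d)) R).submatrix
        (Fin.castAdd d) (Fin.castAdd d)
      map_one' := by
        rw [map_one, Units.val_one]
        exact submatrix_one _ (Fin.castAdd_injective m d)
      map_mul' := fun g h => by
        rw [map_mul, Units.val_mul]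
        exact submatrix_castAdd_mul f hf (fun i j => by simp [key]) (fun i j => by simp [key]) }
  refine ⟨τ₀.toHomUnits, fun g => rfl, ?_⟩
  ext g i j
  change f ((σ g : Matrix _ _ R) (Fin.castAdd d i) (Fin.castAdd d j)) = _
  simp [key]

lemma continuous_bot_of_factors {X Y Z : Type*} [TopologicalSpace X] {f : X → Y} {g : X → Z}
    (hf : Continuous[_, ⊥] f) (h : ∀ a b, f a = f b → g a = g b) : Continuous[_, ⊥] g := by
  let : TopologicalSpace Y := ⊥
  let : TopologicalSpace Z := ⊥
  have : DiscreteTopology Y := ⟨rfl⟩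
  refine continuous_def.2 fun s _ => ?_
  have hs : g ⁻¹' s = f ⁻¹' (f '' (g ⁻¹' s)) := by
    refine (Set.subset_preimage_image _ _).antisymm ?_
    rintro a ⟨b, hb, hab⟩
    rwa [Set.mem_preimage, ← h b a hab]
  rw [hs]
  exact (isOpen_discrete _).preimage hf

lemma wittReduce_ker_mul_eq_zero (p : ℕ) [Fact p.Prime] (k : Type*) [CommRing k] [CharP k p]
    (a b : TruncatedWittVector p 2 k) (ha : wittReduce p k a = 0) (hb : wittReduce p k b = 0) :
    a * b = 0 := by
  obtain ⟨x, rfl⟩ := WittVector.truncate_surjective (p := p) 2 k a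
  obtain ⟨y, rfl⟩ := WittVector.truncate_surjective (p := p) 2 k b
  have exists_verschiebung (z : WittVector p k)
      (hz : wittReduce p k (WittVector.truncate 2 z) = 0) : ∃ w, z = WittVector.verschiebung w := by
    replace hz : z.coeff 0 = 0 := (WittVector.coeff_truncate z 0).symm.trans hz
    exact ⟨_, WittVector.eq_iterate_verschiebung (n := 1) fun i hi => by
      rwa [Nat.lt_one_iff.1 hi]⟩
  obtain ⟨x, rfl⟩ := exists_verschiebung x ha
  obtain ⟨y, rfl⟩ := exists_verschiebung y hb
  rw [← map_mul, ← RingHom.mem_ker, WittVector.mem_ker_truncate]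
  intro i hi
  rw [show WittVector.verschiebung x * WittVector.verschiebung y = _ from
    WittVector.iterate_verschiebung_mul x y 1 1]
  exact WittVector.iterate_verschiebung_coeff_eq_zero _ hi

/-- Lifting in dimension `n` implies lifting in any dimension `m ≤ n`,
both for `GL` and for the Borel subgroups `B`. -/
theorem lifting_reduce_dimension
    (p : ℕ) [Fact p.Prime] (F : Type) [Field F] (k : Type) [Field k] [CharP k p]
    (n m : ℕ) (hm : 0 < m) (hmn : m ≤ n) :
    ((∀ (K : Type) [Field K] [Algebra F K]
        (ρ : Field.absoluteGaloisGroup K →* GL (Fin n) k), Continuous[_, ⊥] ⇑ρ →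
        ∃ ρ' : Field.absoluteGaloisGroup K →* GL (Fin n) (TruncatedWittVector p 2 k),
          Continuous[_, ⊥] ⇑ρ' ∧
            (Matrix.GeneralLinearGroup.map (wittReduce p k)).comp ρ' = ρ) →
      ∀ (K : Type) [Field K] [Algebra F K]
        (ρ : Field.absoluteGaloisGroup K →* GL (Fin m) k), Continuous[_, ⊥] ⇑ρ →
        ∃ ρ' : Field.absoluteGaloisGroup K →* GL (Fin m) (TruncatedWittVector p 2 k),
          Continuous[_, ⊥] ⇑ρ' ∧
            (Matrix.GeneralLinearGroup.map (wittReduce p k)).comp ρ' = ρ) ∧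
    ((∀ (K : Type) [Field K] [Algebra F K]
        (ρ : Field.absoluteGaloisGroup K →* BorelSubgroup n k), Continuous[_, ⊥] ⇑ρ →
        ∃ ρ' : Field.absoluteGaloisGroup K →* BorelSubgroup n (TruncatedWittVector p 2 k),
          Continuous[_, ⊥] ⇑ρ' ∧ (BorelSubgroup.map (wittReduce p k)).comp ρ' = ρ) →
      ∀ (K : Type) [Field K] [Algebra F K]
        (ρ : Field.absoluteGaloisGroup K →* BorelSubgroup m k), Continuous[_, ⊥] ⇑ρ →
        ∃ ρ' : Field.absoluteGaloisGroup K →* BorelSubgroup m (TruncatedWittVector p 2 k),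
          Continuous[_, ⊥] ⇑ρ' ∧ (BorelSubgroup.map (wittReduce p k)).comp ρ' = ρ) := by
  obtain ⟨d, rfl⟩ := Nat.exists_eq_add_of_le hmn
  have hf := wittReduce_ker_mul_eq_zero p k
  refine ⟨fun H K _ _ ρ hρ => ?_, fun H K _ _ ρ hρ => ?_⟩
  · obtain ⟨σ, hσ, hσρ⟩ := H K ((blockExtend m d k).comp ρ)
      (continuous_bot_of_factors hρ fun a b h => congrArg (blockExtend m d k) h)
    obtain ⟨τ, hτ, hτρ⟩ := exists_lift_of_lift_blockExtend _ hf ρ σ hσρ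
    exact ⟨τ, continuous_bot_of_factors hσ fun a b h => Units.ext (by rw [hτ, hτ, h]), hτρ⟩
  · let ρ₀ := (BorelSubgroup m k).subtype.comp ρ
    obtain ⟨σ, hσ, hσρ⟩ := H K (((blockExtend m d k).comp ρ₀).codRestrict (BorelSubgroup (m + d) k)
        fun g => blockExtend_mem_borelSubgroup (ρ g).2)
      (continuous_bot_of_factors hρ fun a b h =>
        Subtype.ext (congrArg (fun A : BorelSubgroup m k => blockExtend m d k A.1) h))
    obtain ⟨τ, hτ, hτρ⟩ := exists_lift_of_lift_blockExtend _ hf ρ₀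
      ((BorelSubgroup (m + d) _).subtype.comp σ)
      (MonoidHom.ext fun g => congrArg Subtype.val (DFunLike.congr_fun hσρ g))
    refine ⟨τ.codRestrict (BorelSubgroup m _) fun g i j hij => ?_,
      continuous_bot_of_factors hσ fun a b h => Subtype.ext (Units.ext ?_),
      MonoidHom.ext fun g => Subtype.ext (DFunLike.congr_fun hτρ g)⟩
    · rw [hτ]
      exact (σ g).2 (i := Fin.castAdd d i) (j := Fin.castAdd d j) hij
    · change (τ a).val = (τ b).val
      rw [hτ, hτ, MonoidHom.comp_apply, MonoidHom.comp_apply, h]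
end

section
/- There exists a group homomorphism s : GL_2(𝔽₃) → GL_2(ℤ/9ℤ) such that the composite of s with the entrywise reduction map GL_2(ℤ/9ℤ) → GL_2(𝔽₃) is the identity on GL_2(𝔽₃). -/
open Matrix Topology

/-- The multiplicative (Teichmüller) section of `ℤ/9ℤ → ℤ/3ℤ`. -/
def teichmullerNine (x : ZMod 3) : ZMod 9 := (x.cast : ZMod 9) ^ 3

/-- The lift to `ℤ/9ℤ` of a matrix entry `a` over `ℤ/3ℤ`, where `b` is the other entry in its row,
`c` the other entry in its column, and `d` the opposite entry. -/
def liftEntry (a b c d : ZMod 3) : ZMod 9 :=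
  teichmullerNine a + 3 * teichmullerNine
    (a * (b ^ 2 + c ^ 2) - b * c * d - a * b ^ 2 * c ^ 2 * d ^ 2)

theorem liftEntry_mul : ∀ a b c d : ZMod 3, a * d - b * c ≠ 0 →
    ∀ a' b' c' d' : ZMod 3, a' * d' - b' * c' ≠ 0 →
    liftEntry (a * a' + b * c') (a * b' + b * d') (c * a' + d * c') (c * b' + d * d') =
      liftEntry a b c d * liftEntry a' b' c' d' + liftEntry b a d c * liftEntry c' d' a' b' := by
  decide +kernel

theorem castHom_liftEntry : ∀ a b c d : ZMod 3,
    ZMod.castHom (show (3 : ℕ) ∣ 9 by norm_num) (ZMod 3) (liftEntry a b c d) = a := by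
  decide +kernel

/-- The entrywise lift of a `2 × 2` matrix over `ℤ/3ℤ` given by `liftEntry`. -/
def liftMatrix (A : Matrix (Fin 2) (Fin 2) (ZMod 3)) : Matrix (Fin 2) (Fin 2) (ZMod 9) :=
  Matrix.of fun i j => liftEntry (A i j) (A i (1 - j)) (A (1 - i) j) (A (1 - i) (1 - j))

theorem liftMatrix_one : liftMatrix 1 = 1 := by
  decide +kernel

theorem liftMatrix_mul {A B : Matrix (Fin 2) (Fin 2) (ZMod 3)} (hA : A.det ≠ 0)
    (hB : B.det ≠ 0) : liftMatrix (A * B) = liftMatrix A * liftMatrix B := by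
  rw [Matrix.det_fin_two] at hA hB
  have hA' : A 1 0 * A 0 1 - A 1 1 * A 0 0 ≠ 0 := fun h => hA (by linear_combination -h)
  have hB' : B 0 1 * B 1 0 - B 0 0 * B 1 1 ≠ 0 := fun h => hB (by linear_combination -h)
  ext i j
  fin_cases i <;> fin_cases j <;>
    simp only [liftMatrix, Matrix.of_apply, Matrix.mul_apply, Fin.sum_univ_two, Fin.zero_eta,
      Fin.mk_one, sub_zero, sub_self]
  · exact liftEntry_mul _ _ _ _ hA _ _ _ _ hB
  · exact liftEntry_mul _ _ _ _ hA _ _ _ _ hB'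
  · exact liftEntry_mul _ _ _ _ hA' _ _ _ _ hB
  · exact liftEntry_mul _ _ _ _ hA' _ _ _ _ hB'

/-- `liftMatrix` as a monoid homomorphism on invertible matrices. -/
def liftHom : GL (Fin 2) (ZMod 3) →* Matrix (Fin 2) (Fin 2) (ZMod 9) where
  toFun g := liftMatrix g.val
  map_one' := liftMatrix_one
  map_mul' g h := liftMatrix_mul g.det_ne_zero h.det_ne_zero

/-- The reduction map `GL₂(ℤ/9ℤ) → GL₂(ℤ/3ℤ)` admits a
group-homomorphism section. -/
theorem gl_two_zmod_nine_splits :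
    ∃ s : GL (Fin 2) (ZMod 3) →* GL (Fin 2) (ZMod 9),
      (Matrix.GeneralLinearGroup.map
          (ZMod.castHom (show (3 : ℕ) ∣ 9 by norm_num) (ZMod 3))).comp s
        = MonoidHom.id (GL (Fin 2) (ZMod 3)) := by
  refine ⟨liftHom.toHomUnits, ?_⟩
  ext g i j
  exact castHom_liftEntry _ _ _ _
end

section
/- There exists a group homomorphism s : GL_3(𝔽₂) → GL_3(ℤ/4ℤ) such that the composite of s with the entrywise reduction map GL_3(ℤ/4ℤ) → GL_3(𝔽₂) is the identity on GL_3(𝔽₂). -/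
open Matrix Topology

/-- Seven vectors of `(ℤ/4ℤ)³`, one above each nonzero vector of `𝔽₂³`, together with their
negatives. -/
def frame : List (Fin 3 → ZMod 4) :=
  [![1, 0, 0], ![0, 1, 0], ![0, 0, 1], ![1, 1, 3], ![1, 2, 1], ![1, 3, 2], ![2, 1, 1],
   ![3, 0, 0], ![0, 3, 0], ![0, 0, 3], ![3, 3, 1], ![3, 2, 3], ![3, 1, 2], ![2, 3, 3]]

/-- The matrices of determinant one over `ℤ/4ℤ` that preserve `frame`. -/
def frameStabilizer : Subgroup (GL (Fin 3) (ZMod 4)) where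
  carrier := {M | M.val.det = 1 ∧ ∀ v, M.val *ᵥ v ∈ frame ↔ v ∈ frame}
  one_mem' := by simp
  mul_mem' := by
    rintro M N ⟨hM, hM'⟩ ⟨hN, hN'⟩
    refine ⟨by simp [hM, hN], fun v => ?_⟩
    rw [Units.val_mul, ← mulVec_mulVec, hM', hN']
  inv_mem' := by
    rintro M ⟨hM, hM'⟩
    refine ⟨?_, fun v => ?_⟩
    · have h : (M.val * M⁻¹.val).det = 1 := by rw [Units.mul_inv, det_one]
      rwa [det_mul, hM, one_mul] at h
    · rw [← hM', mulVec_mulVec, Units.mul_inv, one_mulVec]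

/-- Entrywise reduction `GL₃(ℤ/4ℤ) → GL₃(𝔽₂)`. -/
abbrev reduction : GL (Fin 3) (ZMod 4) →* GL (Fin 3) (ZMod 2) :=
  Matrix.GeneralLinearGroup.map (ZMod.castHom (show (2 : ℕ) ∣ 4 by norm_num) (ZMod 2))

theorem eq_or_eq_neg_single_of_mem_frame (i : Fin 3) : ∀ v ∈ frame,
    (∀ j, ZMod.castHom (show (2 : ℕ) ∣ 4 by norm_num) (ZMod 2) (v j) =
      (1 : Matrix (Fin 3) (Fin 3) (ZMod 2)) j i) →
    v = Pi.single i 1 ∨ v = Pi.single i 3 := by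
  revert i
  decide

theorem single_mem_frame (i : Fin 3) : Pi.single i 1 ∈ frame := by
  revert i
  decide

theorem eq_one_of_mem_frameStabilizer {M : GL (Fin 3) (ZMod 4)} (hM : M ∈ frameStabilizer)
    (h : reduction M = 1) : M = 1 := by
  obtain ⟨hdet, hfr⟩ := hM
  have hcol (i : Fin 3) : M.val.col i = Pi.single i 1 ∨ M.val.col i = Pi.single i 3 := by
    refine eq_or_eq_neg_single_of_mem_frame i _ ?_ fun j => ?_
    · rw [← mulVec_single_one, hfr]
      exact single_mem_frame i
    · exact congrArg (fun N : GL (Fin 3) (ZMod 2) => N.val j i) h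
  have hdiag : ∃ a b c : ZMod 4, (a = 1 ∨ a = 3) ∧ (b = 1 ∨ b = 3) ∧ (c = 1 ∨ c = 3) ∧
      M.val = diagonal ![a, b, c] := by
    have key (i : Fin 3) : ∃ a : ZMod 4, (a = 1 ∨ a = 3) ∧ M.val.col i = Pi.single i a := by
      rcases hcol i with h | h
      exacts [⟨1, .inl rfl, h⟩, ⟨3, .inr rfl, h⟩]
    obtain ⟨a, ha, ha'⟩ := key 0
    obtain ⟨b, hb, hb'⟩ := key 1
    obtain ⟨c, hc, hc'⟩ := key 2
    refine ⟨a, b, c, ha, hb, hc, ?_⟩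
    ext i j
    fin_cases j
    · exact (congrFun ha' i).trans (by fin_cases i <;> rfl)
    · exact (congrFun hb' i).trans (by fin_cases i <;> rfl)
    · exact (congrFun hc' i).trans (by fin_cases i <;> rfl)
  obtain ⟨a, b, c, ha, hb, hc, hM⟩ := hdiag
  have hv := (hfr ![1, 1, 3]).2 (by decide)
  rw [hM] at hdet hv
  have habc : a = 1 ∧ b = 1 ∧ c = 1 := by
    rw [det_diagonal] at hdet
    clear hM hcol hfr h
    revert a b c
    decide
  obtain ⟨rfl, rfl, rfl⟩ := habc
  apply Units.ext
  rw [hM]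
  decide

/-- For `i ≠ j`, the element of `frameStabilizer` that reduces to the transvection
`1 + single i j 1`. -/
def transvectionLift : Fin 3 → Fin 3 → Matrix (Fin 3) (Fin 3) (ZMod 4) :=
  ![![1, !![1, 1, 0; 0, 3, 0; 0, 2, 3], !![1, 0, 3; 0, 3, 2; 0, 0, 3]],
    ![!![3, 0, 0; 1, 1, 0; 2, 0, 3], 1, !![3, 0, 2; 0, 1, 3; 0, 0, 3]],
    ![!![3, 0, 0; 2, 3, 0; 3, 0, 1], !![3, 2, 0; 0, 3, 0; 0, 3, 1], 1]]

theorem transvectionLift_mul_self : ∀ i j, transvectionLift i j * transvectionLift i j = 1 := by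
  decide

theorem det_transvectionLift : ∀ i j, (transvectionLift i j).det = 1 := by
  decide

theorem transvectionLift_mulVec_mem_frame :
    ∀ i j, ∀ v ∈ frame, transvectionLift i j *ᵥ v ∈ frame := by
  decide

theorem transvectionLift_map : ∀ i j, i ≠ j →
    (transvectionLift i j).map (ZMod.castHom (show (2 : ℕ) ∣ 4 by norm_num) (ZMod 2)) =
      transvection i j 1 := by
  decide

theorem exists_lift_transvection {i j : Fin 3} (hij : i ≠ j) (c : ZMod 2) :
    ∃ M ∈ frameStabilizer, (reduction M).val = transvection i j c := by
  obtain rfl | rfl : c = 0 ∨ c = 1 := by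
    revert c
    decide
  · exact ⟨1, one_mem _, by rw [map_one, transvection_zero, Units.val_one]⟩
  · have hsq := transvectionLift_mul_self i j
    refine ⟨⟨transvectionLift i j, transvectionLift i j, hsq, hsq⟩,
      ⟨det_transvectionLift i j, fun v => ⟨fun hv => ?_, ?_⟩⟩, transvectionLift_map i j hij⟩
    · simpa only [mulVec_mulVec, hsq, one_mulVec] using
        transvectionLift_mulVec_mem_frame i j _ hv
    · exact transvectionLift_mulVec_mem_frame i j v

theorem exists_lift (A : Matrix (Fin 3) (Fin 3) (ZMod 2)) (hA : A.det ≠ 0) :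
    ∃ M ∈ frameStabilizer, (reduction M).val = A := by
  refine diagonal_transvection_induction_of_det_ne_zero
    (fun A => ∃ M ∈ frameStabilizer, (reduction M).val = A) A hA (fun D hD => ?_)
    (fun t => exists_lift_transvection t.hij t.c) ?_
  · have hone : ∀ x : ZMod 2, x ≠ 0 → x = 1 := by decide
    have hD' : D = 1 := by
      rw [det_diagonal, Finset.prod_ne_zero_iff] at hD
      exact funext fun i => hone _ (hD i (Finset.mem_univ i))
    exact ⟨1, one_mem _, by rw [map_one, hD', Units.val_one, diagonal_one']⟩
  · rintro _ _ - - ⟨M, hM, rfl⟩ ⟨N, hN, rfl⟩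
    exact ⟨M * N, mul_mem hM hN, by rw [map_mul, Units.val_mul]⟩

/-- The reduction map `GL₃(ℤ/4ℤ) → GL₃(ℤ/2ℤ)` admits a
group-homomorphism section. -/
theorem gl_three_zmod_four_splits :
    ∃ s : GL (Fin 3) (ZMod 2) →* GL (Fin 3) (ZMod 4),
      (Matrix.GeneralLinearGroup.map
          (ZMod.castHom (show (2 : ℕ) ∣ 4 by norm_num) (ZMod 2))).comp s
        = MonoidHom.id (GL (Fin 3) (ZMod 2)) := by
  have hbij : Function.Bijective (reduction.comp frameStabilizer.subtype) := by
    constructor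
    · rw [injective_iff_map_eq_one]
      exact fun M hM => Subtype.ext (eq_one_of_mem_frameStabilizer M.2 hM)
    · intro A
      obtain ⟨M, hM, h⟩ := exists_lift A.val (A.isUnit.map detMonoidHom).ne_zero
      exact ⟨⟨M, hM⟩, Units.ext h⟩
  let e := MulEquiv.ofBijective _ hbij
  exact ⟨frameStabilizer.subtype.comp e.symm.toMonoidHom, MonoidHom.ext e.apply_symm_apply⟩
end
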